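/- arXiv:1404.6263 — 5 statements merged into one kernel-verified Lean document; each statement's English description precedes it below -/
import Mathlib

section
/- For every bounded poset P, the Kalmbach extension K(P), equipped with the given partial order and the orthocomplementation C^⊥ = C Δ {0,1}, is an orthomodular poset. -/
attribute [local instance] Classical.propDecidable

universe u v w

/- Kalmbach extension machinery, parameterized by an explicit order relation. -/



/-- `C` is a finite chain with an even number of elements w.r.t. the order `r`. -/
def IsEvenChainR {α : Type u} (r : α → α → Prop) (C : Finset α) : Prop :=
  (∀ a ∈ C, ∀ b ∈ C, r a b ∨ r b a) ∧ Even C.card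

/-- `(a, b)` is one of the consecutive pairs `(x_{2i-1}, x_{2i})` of the even chain
`C = [x₁ < x₂ < … < x_{2n}]`: both belong to `C`, `a` occupies an odd position
(the number of elements of `C` below `a` is odd) and `b` is the immediate successor
of `a` in `C`. -/
def KalPairR {α : Type u} (r : α → α → Prop) (C : Finset α) (a b : α) : Prop :=
  a ∈ C ∧ b ∈ C ∧ r a b ∧ a ≠ b ∧
    Odd (C.filter fun y => r y a).card ∧
    (∀ c ∈ C, r a c → c ≠ a → r b c)

/-- The Kalmbach order: `[x₁<x₂<…<x_{2n}] ≤ [y₁<y₂<…<y_{2k}]` iff for every `i`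
there is `j` with `y_{2j-1} ≤ x_{2i-1} < x_{2i} ≤ y_{2j}`. -/
def KalLER {α : Type u} (r : α → α → Prop) (C D : Finset α) : Prop :=
  ∀ a b, KalPairR r C a b → ∃ c d, KalPairR r D c d ∧ r c a ∧ r b d

/-- The carrier of the Kalmbach extension `K(P)`: all finite chains with an even
number of elements (with elements taken from the carrier `S`). -/
def KalCarrier {α : Type u} (S : Set α) (r : α → α → Prop) : Set (Finset α) :=
  {C | ↑C ⊆ S ∧ IsEvenChainR r C}

/-- Orthocomplementation on the Kalmbach extension: `C ↦ C Δ {0, 1}`. -/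
noncomputable def kalComplF {α : Type u} (z u : α) (C : Finset α) : Finset α :=
  symmDiff C {z, u}

/-- The unit `η` of the Kalmbach adjunction: `η(0) = ∅` and `η(a) = [0 < a]` for `a > 0`. -/
noncomputable def kalEtaF {α : Type u} (z : α) (a : α) : Finset α :=
  if a = z then ∅ else {z, a}

/-- Symmetric difference of a finite family of finite sets:
`Δᵢ Cᵢ = {x | x belongs to an odd number of the Cᵢ}`. -/
noncomputable def kalMuF {α : Type u} (𝒞 : Finset (Finset α)) : Finset α :=
  (𝒞.sup id).filter fun x => Odd (𝒞.filter fun C => x ∈ C).card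

/-- `K(f)(C) = Δ_{x ∈ C} {f x}`, i.e. the set of `y` such that the number of
elements of `C` mapped to `y` is odd. -/
noncomputable def kalMapF {α : Type u} {β : Type v} (f : α → β) (C : Finset α) : Finset β :=
  (C.image f).filter fun y => Odd (C.filter fun x => f x = y).card

/-- Enumerate a finite chain in increasing order (w.r.t. `r`) as a list. -/
noncomputable def chainSortR {α : Type u} (r : α → α → Prop) (C : Finset α) : List α :=
  C.toList.mergeSort fun a b => decide (r a b)

/- Relative suprema/infima and orthomodular posets presented on a carrier set. -/

/-- `z` is the least upper bound of `x` and `y` within the carrier `S`, w.r.t. `r`. -/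
def RelLUB {α : Type u} (S : Set α) (r : α → α → Prop) (x y z : α) : Prop :=
  z ∈ S ∧ r x z ∧ r y z ∧ ∀ w ∈ S, r x w → r y w → r z w

/-- `z` is the greatest lower bound of `x` and `y` within the carrier `S`, w.r.t. `r`. -/
def RelGLB {α : Type u} (S : Set α) (r : α → α → Prop) (x y z : α) : Prop :=
  z ∈ S ∧ r z x ∧ r z y ∧ ∀ w ∈ S, r w x → r w y → r w z

/-- `(S, r, oc, z, u)` is an orthomodular poset: `(S, r, z, u)` is a bounded poset and
`oc` is an orthocomplementation satisfying antitonicity, involutivity, `x ∧ x' = 0`,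
existence of joins of orthogonal pairs, and the orthomodular law
`x ≤ y → x ∨ (x ∨ y')' = y`. -/
structure IsOrthomodularPosetOn {α : Type u} (S : Set α) (r : α → α → Prop)
    (oc : α → α) (z u : α) : Prop where
  bot_mem : z ∈ S
  top_mem : u ∈ S
  compl_mem : ∀ x ∈ S, oc x ∈ S
  refl : ∀ x ∈ S, r x x
  antisymm : ∀ x ∈ S, ∀ y ∈ S, r x y → r y x → x = y
  trans : ∀ x ∈ S, ∀ y ∈ S, ∀ w ∈ S, r x y → r y w → r x w
  bot_le : ∀ x ∈ S, r z x
  le_top : ∀ x ∈ S, r x u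
  compl_anti : ∀ x ∈ S, ∀ y ∈ S, r x y → r (oc y) (oc x)
  compl_compl : ∀ x ∈ S, oc (oc x) = x
  inf_compl : ∀ x ∈ S, RelGLB S r x (oc x) z
  sup_of_orth : ∀ x ∈ S, ∀ y ∈ S, r x (oc y) → ∃ j, RelLUB S r x y j
  orthomodular : ∀ x ∈ S, ∀ y ∈ S, r x y →
    ∃ j, RelLUB S r x (oc y) j ∧ RelLUB S r x (oc j) y


section KalHelpers
variable {P : Type u} [PartialOrder P]

def KChain (C : Finset P) : Prop := ∀ a ∈ C, ∀ b ∈ C, a ≤ b ∨ b ≤ a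

def KU (C : Finset P) (p : P) : Prop := Odd (C.filter fun y => y ≤ p).card

theorem odd_card_symmDiff (A B : Finset P) :
    Odd (symmDiff A B).card ↔ ¬ (Odd A.card ↔ Odd B.card) := by
  have h1 : (symmDiff A B).card = (A \ B).card + (B \ A).card := by
    rw [symmDiff_def, Finset.sup_eq_union, Finset.card_union_of_disjoint disjoint_sdiff_sdiff]
  have h2 := Finset.card_sdiff_add_card_inter A B
  have h3 := Finset.card_sdiff_add_card_inter B A
  rw [Finset.inter_comm] at h3
  rw [h1, ← h2, ← h3]
  simp only [Nat.odd_iff]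
  omega

theorem KU_symmDiff (C D : Finset P) (p : P) :
    KU (symmDiff C D) p ↔ ¬ (KU C p ↔ KU D p) := by
  unfold KU
  rw [← odd_card_symmDiff]
  have : (symmDiff C D).filter (fun y => y ≤ p)
      = symmDiff (C.filter fun y => y ≤ p) (D.filter fun y => y ≤ p) := by
    ext x
    simp only [Finset.mem_filter, Finset.mem_symmDiff]
    tauto
  rw [this]

theorem KU_empty_of (C : Finset P) (h : ∀ p, ¬ KU C p) : C = ∅ := by
  by_contra hC
  obtain ⟨m, hm, hmin⟩ := C.exists_minimal (Finset.nonempty_iff_ne_empty.2 hC)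
  apply h m
  have : C.filter (fun y => y ≤ m) = {m} := by
    ext x
    simp only [Finset.mem_filter, Finset.mem_singleton]
    constructor
    · rintro ⟨hx, hxm⟩
      exact le_antisymm hxm (hmin hx hxm)
    · rintro rfl
      exact ⟨hm, le_rfl⟩
  unfold KU
  rw [this]
  simp

theorem KU_inj (C D : Finset P) (h : ∀ p, KU C p ↔ KU D p) : C = D := by
  have : symmDiff C D = ∅ := KU_empty_of _ fun p => by
    rw [KU_symmDiff]
    have := h p
    tauto
  exact symmDiff_eq_bot.1 this

theorem pair_of_lower (C T : Finset P) (hC : KChain C) (he : Even C.card) (hT : T ⊆ C)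
    (hl : ∀ y ∈ T, ∀ z ∈ C, z ≤ y → z ∈ T) (ho : Odd T.card) :
    ∃ a b, KalPairR (· ≤ ·) C a b ∧ a ∈ T ∧ b ∉ T ∧ (∀ y ∈ T, y ≤ a) ∧
      ∀ z ∈ C, z ∉ T → b ≤ z := by
  have hne : T.Nonempty := by
    rw [← Finset.card_pos]; exact ho.pos
  obtain ⟨a, ha, hamax⟩ := T.exists_maximal hne
  have hne2 : (C \ T).Nonempty := by
    rw [Finset.nonempty_iff_ne_empty]
    intro h0
    have : C = T := Finset.Subset.antisymm (Finset.sdiff_eq_empty_iff_subset.1 h0) hT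
    rw [this] at he
    exact (Nat.not_even_iff_odd.2 ho) he
  obtain ⟨b, hb, hbmin⟩ := (C \ T).exists_minimal hne2
  rw [Finset.mem_sdiff] at hb
  have hA : ∀ y ∈ T, y ≤ a := fun y hy => by
    rcases hC y (hT hy) a (hT ha) with h | h
    · exact h
    · exact hamax hy h
  have hB : ∀ z ∈ C, z ∉ T → b ≤ z := fun z hz hzT => by
    rcases hC b hb.1 z hz with h | h
    · exact h
    · exact hbmin (Finset.mem_sdiff.2 ⟨hz, hzT⟩) h
  have hab : a ≤ b := by
    rcases hC a (hT ha) b hb.1 with h | h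
    · exact h
    · exact absurd (hl a ha b hb.1 h) hb.2
  refine ⟨a, b, ⟨hT ha, hb.1, hab, ?_, ?_, ?_⟩, ha, hb.2, hA, hB⟩
  · rintro rfl; exact hb.2 ha
  · have : C.filter (fun y => y ≤ a) = T := by
      ext x
      simp only [Finset.mem_filter]
      exact ⟨fun h => hl a ha x h.1 h.2, fun h => ⟨hT h, hA x h⟩⟩
    rw [this]; exact ho
  · intro c hc hac hca
    exact hB c hc fun hcT => hca (le_antisymm (hA c hcT) hac)

theorem pair_of_KU {C : Finset P} (hC : KChain C) (he : Even C.card) {p : P} (hp : KU C p) :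
    ∃ a b, KalPairR (· ≤ ·) C a b ∧ a ≤ p ∧ ¬ b ≤ p := by
  obtain ⟨a, b, h, ha, hb, -, -⟩ := pair_of_lower C (C.filter fun y => y ≤ p) hC he
    (Finset.filter_subset _ _) (fun y hy z hz hzy => by
      rw [Finset.mem_filter] at hy ⊢
      exact ⟨hz, hzy.trans hy.2⟩) hp
  rw [Finset.mem_filter] at ha hb
  exact ⟨a, b, h, ha.2, fun h' => hb ⟨h.2.1, h'⟩⟩

theorem KU_of_pair {C : Finset P} (hC : KChain C) {a b p : P}
    (h : KalPairR (· ≤ ·) C a b) (ha : a ≤ p) (hb : ¬ b ≤ p) : KU C p := by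
  obtain ⟨haC, hbC, hab, hne, ho, hs⟩ := h
  have : C.filter (fun y => y ≤ p) = C.filter (fun y => y ≤ a) := by
    ext x
    simp only [Finset.mem_filter]
    constructor
    · rintro ⟨hx, hxp⟩
      refine ⟨hx, ?_⟩
      by_contra hxa
      rcases hC x hx a haC with h | h
      · exact hxa h
      · exact hb ((hs x hx h (fun e => hxa e.le)).trans hxp)
    · rintro ⟨hx, hxa⟩
      exact ⟨hx, hxa.trans ha⟩
  unfold KU
  rw [this]
  exact ho

theorem not_KU_of_pair {C : Finset P} (hC : KChain C) {a b : P}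
    (h : KalPairR (· ≤ ·) C a b) : ¬ KU C b := by
  obtain ⟨haC, hbC, hab, hne, ho, hs⟩ := h
  have hba : ¬ b ≤ a := fun h => hne (le_antisymm hab h)
  have : C.filter (fun y => y ≤ b) = insert b (C.filter (fun y => y ≤ a)) := by
    ext x
    simp only [Finset.mem_filter, Finset.mem_insert]
    constructor
    · rintro ⟨hx, hxb⟩
      by_cases hxa : x ≤ a
      · exact Or.inr ⟨hx, hxa⟩
      · left
        rcases hC x hx a haC with h | h
        · exact absurd h hxa
        · exact le_antisymm hxb (hs x hx h (fun e => hxa e.le))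
    · rintro (rfl | ⟨hx, hxa⟩)
      · exact ⟨hbC, le_rfl⟩
      · exact ⟨hx, hxa.trans hab⟩
  unfold KU
  rw [this, Finset.card_insert_of_notMem (by simp [hba]), Nat.not_odd_iff_even]
  exact ho.add_one

theorem mem_pair {C : Finset P} (hC : KChain C) (he : Even C.card) {x : P} (hx : x ∈ C) :
    ∃ a b, KalPairR (· ≤ ·) C a b ∧ (x = a ∨ x = b) := by
  by_cases hU : KU C x
  · obtain ⟨a, b, h, ha, hb⟩ := pair_of_KU hC he hU
    refine ⟨a, b, h, Or.inl ?_⟩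
    by_contra hne
    exact hb (h.2.2.2.2.2 x hx ha hne)
  · have hcard : C.filter (fun y => y ≤ x) = insert x (C.filter (fun y => y < x)) := by
      ext y
      simp only [Finset.mem_filter, Finset.mem_insert]
      constructor
      · rintro ⟨h1, h2⟩
        rcases h2.eq_or_lt with h | h
        · exact Or.inl h
        · exact Or.inr ⟨h1, h⟩
      · rintro (rfl | ⟨h1, h2⟩)
        · exact ⟨hx, le_rfl⟩
        · exact ⟨h1, h2.le⟩
    unfold KU at hU
    rw [hcard, Finset.card_insert_of_notMem (by simp)] at hU
    have ho : Odd (C.filter (fun y => y < x)).card := by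
      simp only [Nat.odd_iff] at hU ⊢
      omega
    obtain ⟨a, b, h, ha, hb, -, hB⟩ := pair_of_lower C (C.filter fun y => y < x) hC he
      (Finset.filter_subset _ _) (fun y hy z hz hzy => by
        rw [Finset.mem_filter] at hy ⊢
        exact ⟨hz, hzy.trans_lt hy.2⟩) ho
    refine ⟨a, b, h, Or.inr ?_⟩
    have h1 : b ≤ x := hB x hx (by simp)
    by_contra hne
    exact hb (Finset.mem_filter.2 ⟨h.2.1, lt_of_le_of_ne h1 (Ne.symm hne)⟩)

def KComp (C D : Finset P) : Prop := ∀ a ∈ C, ∀ b ∈ D, a ≤ b ∨ b ≤ a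

theorem KalLE_iff {C D : Finset P} (hC : KChain C) (heC : Even C.card)
    (hD : KChain D) (heD : Even D.card) :
    KalLER (· ≤ ·) C D ↔ KComp C D ∧ ∀ p, KU C p → KU D p := by
  constructor
  · intro h
    constructor
    · intro x hx y hy
      obtain ⟨a, b, hab, hxab⟩ := mem_pair hC heC hx
      obtain ⟨c, d, hcd, hca, hbd⟩ := h a b hab
      have h1 : a ≤ x ∧ x ≤ b := by
        have := hab.2.2.1
        rcases hxab with rfl | rfl
        · exact ⟨le_rfl, this⟩
        · exact ⟨this, le_rfl⟩
      by_cases hyc : y ≤ c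
      · exact Or.inr (hyc.trans (hca.trans h1.1))
      · rcases hD y hy c hcd.1 with h' | h'
        · exact absurd h' hyc
        · exact Or.inl (h1.2.trans (hbd.trans (hcd.2.2.2.2.2 y hy h' (fun e => hyc e.le))))
    · intro p hp
      obtain ⟨a, b, hab, ha, hb⟩ := pair_of_KU hC heC hp
      obtain ⟨c, d, hcd, hca, hbd⟩ := h a b hab
      exact KU_of_pair hD hcd (le_trans hca ha) fun h' => hb (le_trans hbd h')
  · rintro ⟨hCD, hU⟩ a b hab
    have hba : ¬ b ≤ a := fun h => hab.2.2.2.1 (le_antisymm hab.2.2.1 h)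
    obtain ⟨c, d, hcd, hca, hda⟩ := pair_of_KU hD heD (hU a (KU_of_pair hC hab le_rfl hba))
    refine ⟨c, d, hcd, hca, ?_⟩
    by_contra hbd
    have had : a ≤ d := (hCD a hab.1 d hcd.2.1).resolve_right hda
    exact not_KU_of_pair hD hcd (hU d (KU_of_pair hC hab had hbd))

theorem KComp.symm {C D : Finset P} (h : KComp C D) : KComp D C :=
  fun a ha b hb => (h b hb a ha).symm

theorem KComp.symmDiff_right {C D E : Finset P} (h : KComp C D) (h' : KComp C E) :
    KComp C (symmDiff D E) := by
  intro a ha b hb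
  rw [Finset.mem_symmDiff] at hb
  rcases hb with hb | hb
  · exact h a ha b hb.1
  · exact h' a ha b hb.1

theorem KComp.symmDiff_left {C D E : Finset P} (h : KComp D C) (h' : KComp E C) :
    KComp (symmDiff D E) C := (h.symm.symmDiff_right h'.symm).symm

theorem KCar_iff {C : Finset P} :
    C ∈ KalCarrier Set.univ ((· ≤ ·) : P → P → Prop) ↔ KComp C C ∧ Even C.card := by
  simp [KalCarrier, IsEvenChainR, KComp]

theorem KLE_iff {C D : Finset P} (hC : C ∈ KalCarrier Set.univ ((· ≤ ·) : P → P → Prop))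
    (hD : D ∈ KalCarrier Set.univ ((· ≤ ·) : P → P → Prop)) :
    KalLER (· ≤ ·) C D ↔ KComp C D ∧ ∀ p, KU C p → KU D p := by
  rw [KCar_iff] at hC hD
  exact KalLE_iff hC.1 hC.2 hD.1 hD.2

theorem KCar_symmDiff {C D : Finset P} (hC : C ∈ KalCarrier Set.univ ((· ≤ ·) : P → P → Prop))
    (hD : D ∈ KalCarrier Set.univ ((· ≤ ·) : P → P → Prop)) (h : KComp C D) :
    symmDiff C D ∈ KalCarrier Set.univ ((· ≤ ·) : P → P → Prop) := by
  rw [KCar_iff] at *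
  refine ⟨(hC.1.symmDiff_right h).symmDiff_left (h.symm.symmDiff_right hD.1), ?_⟩
  have := odd_card_symmDiff C D
  rw [← Nat.not_odd_iff_even] at *
  tauto

theorem KLUB {C D : Finset P} (hC : C ∈ KalCarrier Set.univ ((· ≤ ·) : P → P → Prop))
    (hD : D ∈ KalCarrier Set.univ ((· ≤ ·) : P → P → Prop)) (h : KComp C D)
    (hdis : ∀ p, KU C p → ¬ KU D p) :
    RelLUB (KalCarrier Set.univ ((· ≤ ·) : P → P → Prop)) (KalLER (· ≤ ·)) C D
      (symmDiff C D) := by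
  have hJ := KCar_symmDiff hC hD h
  have hC' := (KCar_iff.1 hC).1
  have hD' := (KCar_iff.1 hD).1
  refine ⟨hJ, ?_, ?_, ?_⟩
  · rw [KLE_iff hC hJ]
    refine ⟨hC'.symmDiff_right h, fun p hp => ?_⟩
    rw [KU_symmDiff]
    have := hdis p
    tauto
  · rw [KLE_iff hD hJ]
    refine ⟨h.symm.symmDiff_right hD', fun p hp => ?_⟩
    rw [KU_symmDiff]
    have := hdis p
    tauto
  · intro W hW h1 h2
    rw [KLE_iff hC hW] at h1
    rw [KLE_iff hD hW] at h2
    rw [KLE_iff hJ hW]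
    refine ⟨h1.1.symmDiff_left h2.1, fun p hp => ?_⟩
    rw [KU_symmDiff] at hp
    have := h1.2 p
    have := h2.2 p
    tauto

variable [BoundedOrder P]

theorem KComp_top (C : Finset P) : KComp C {⊥, ⊤} := by
  intro a _ b hb
  simp only [Finset.mem_insert, Finset.mem_singleton] at hb
  rcases hb with rfl | rfl
  · exact Or.inr bot_le
  · exact Or.inl le_top

theorem not_KU_top {C : Finset P} (hC : C ∈ KalCarrier Set.univ ((· ≤ ·) : P → P → Prop)) :
    ¬ KU C ⊤ := by
  rw [KCar_iff] at hC
  simpa [KU] using hC.2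

variable [Nontrivial P]

theorem KCar_top : ({⊥, ⊤} : Finset P) ∈ KalCarrier Set.univ ((· ≤ ·) : P → P → Prop) := by
  rw [KCar_iff]
  refine ⟨KComp_top _, ?_⟩
  rw [Finset.card_pair bot_ne_top]
  exact even_two

theorem KU_top {p : P} : KU ({⊥, ⊤} : Finset P) p ↔ p ≠ ⊤ := by
  constructor
  · rintro h rfl
    exact not_KU_top KCar_top h
  · intro h
    have : ({⊥, ⊤} : Finset P).filter (fun y => y ≤ p) = {⊥} := by
      ext x
      simp only [Finset.mem_filter, Finset.mem_insert, Finset.mem_singleton]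
      constructor
      · rintro ⟨rfl | rfl, hx⟩
        · rfl
        · exact absurd (top_le_iff.1 hx) h
      · rintro rfl
        exact ⟨Or.inl rfl, bot_le⟩
    unfold KU
    rw [this]
    simp

theorem KCar_compl {C : Finset P} (hC : C ∈ KalCarrier Set.univ ((· ≤ ·) : P → P → Prop)) :
    kalComplF ⊥ ⊤ C ∈ KalCarrier Set.univ ((· ≤ ·) : P → P → Prop) :=
  KCar_symmDiff hC KCar_top (KComp_top C)

theorem KU_compl {C : Finset P} (hC : C ∈ KalCarrier Set.univ ((· ≤ ·) : P → P → Prop)) (p : P) :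
    KU (kalComplF ⊥ ⊤ C) p ↔ p ≠ ⊤ ∧ ¬ KU C p := by
  unfold kalComplF
  rw [KU_symmDiff, KU_top]
  by_cases h : p = ⊤
  · subst h
    have := not_KU_top hC
    tauto
  · tauto

theorem KComp_compl {C D : Finset P} (h : KComp C D) : KComp C (kalComplF ⊥ ⊤ D) :=
  h.symmDiff_right (KComp_top C)

theorem kcompl_compl (C : Finset P) : kalComplF ⊥ ⊤ (kalComplF ⊥ ⊤ C) = C := by
  unfold kalComplF
  exact symmDiff_symmDiff_cancel_right _ _

end KalHelpers

/-- For every bounded poset `P`, the Kalmbach extension `K(P)`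
(the even-length finite chains in `P` with the Kalmbach order), equipped with the
orthocomplementation `C ↦ C Δ {0,1}`, is an orthomodular poset. -/
theorem kalmbach_extension_is_orthomodular_poset
    (P : Type u) [PartialOrder P] [BoundedOrder P] [Nontrivial P] :
    IsOrthomodularPosetOn (KalCarrier Set.univ ((· ≤ ·) : P → P → Prop))
      (KalLER (· ≤ ·)) (kalComplF (⊥ : P) ⊤) (∅ : Finset P) ({⊥, ⊤} : Finset P) := by
  have hbot : (∅ : Finset P) ∈ KalCarrier Set.univ ((· ≤ ·) : P → P → Prop) := by
    rw [KCar_iff]; simp [KComp]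
  have hbl : ∀ x : Finset P, KalLER (· ≤ ·) ∅ x := by
    intro x a b h
    exact absurd h.1 (by simp)
  have hsup : ∀ x ∈ KalCarrier Set.univ ((· ≤ ·) : P → P → Prop),
      ∀ y ∈ KalCarrier Set.univ ((· ≤ ·) : P → P → Prop),
      KalLER (· ≤ ·) x (kalComplF ⊥ ⊤ y) →
      RelLUB (KalCarrier Set.univ ((· ≤ ·) : P → P → Prop)) (KalLER (· ≤ ·)) x y
        (symmDiff x y) := by
    intro x hx y hy h
    rw [KLE_iff hx (KCar_compl hy)] at h
    refine KLUB hx hy ?_ fun p hp => ((KU_compl hy p).1 (h.2 p hp)).2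
    have := KComp_compl h.1
    rwa [kcompl_compl] at this
  refine ⟨hbot, KCar_top, fun x hx => KCar_compl hx, ?_, ?_, ?_, fun x _ => hbl x, ?_, ?_,
    fun x _ => kcompl_compl x, ?_, fun x hx y hy h => ⟨_, hsup x hx y hy h⟩, ?_⟩
  · intro x hx
    rw [KLE_iff hx hx]
    exact ⟨(KCar_iff.1 hx).1, fun _ h => h⟩
  · intro x hx y hy h1 h2
    rw [KLE_iff hx hy] at h1
    rw [KLE_iff hy hx] at h2
    exact KU_inj x y fun p => ⟨h1.2 p, h2.2 p⟩
  · intro x _ y _ w _ h1 h2 a b hab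
    obtain ⟨c, d, hcd, h3, h4⟩ := h1 a b hab
    obtain ⟨e, f, hef, h5, h6⟩ := h2 c d hcd
    exact ⟨e, f, hef, le_trans h5 h3, le_trans h4 h6⟩
  · intro x hx
    rw [KLE_iff hx KCar_top]
    refine ⟨KComp_top x, fun p hp => KU_top.2 ?_⟩
    rintro rfl
    exact not_KU_top hx hp
  · intro x hx y hy h
    rw [KLE_iff hx hy] at h
    rw [KLE_iff (KCar_compl hy) (KCar_compl hx)]
    refine ⟨KComp_compl (KComp_compl h.1).symm, fun p hp => ?_⟩
    rw [KU_compl hy] at hp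
    rw [KU_compl hx]
    exact ⟨hp.1, fun h' => hp.2 (h.2 p h')⟩
  · intro x hx
    refine ⟨hbot, hbl _, hbl _, fun w hw h1 h2 => ?_⟩
    rw [KLE_iff hw hx] at h1
    rw [KLE_iff hw (KCar_compl hx)] at h2
    have : w = ∅ := KU_empty_of w fun p hp => ((KU_compl hx p).1 (h2.2 p hp)).2 (h1.2 p hp)
    rw [this]
    exact hbl _
  · intro x hx y hy h
    refine ⟨_, hsup x hx _ (KCar_compl hy) (by rw [kcompl_compl]; exact h), ?_⟩
    rw [KLE_iff hx hy] at h
    have e : kalComplF ⊥ ⊤ (symmDiff x (kalComplF ⊥ ⊤ y)) = symmDiff x y := by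
      unfold kalComplF
      rw [← symmDiff_assoc, symmDiff_symmDiff_cancel_right]
    rw [e]
    have := KLUB hx (KCar_symmDiff hx hy h.1) ((KCar_iff.1 hx).1.symmDiff_right h.1)
      (fun p hp h' => by
        rw [KU_symmDiff] at h'
        have := h.2 p
        tauto)
    rwa [symmDiff_symmDiff_cancel_left] at this
end

section
/- For every bounded poset P, the map η_P : P → K(P) defined by η_P(0) = ∅ and η_P(a) = [0<a] for a > 0 is an order embedding of bounded posets (it preserves 0 and 1, and a ≤ b in P if and only if η_P(a) ≤ η_P(b) in K(P)); hence every bounded poset embeds into an orthomodular poset. -/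
attribute [local instance] Classical.propDecidable

universe u v w

namespace KalAux

variable {P : Type u} [PartialOrder P]

def Ch (C : Finset P) : Prop := ∀ a ∈ C, ∀ b ∈ C, a ≤ b ∨ b ≤ a

def S (C : Finset P) (x : P) : Prop := Odd (C.filter fun y => y ≤ x).card

theorem Ch.mono {C D : Finset P} (h : Ch D) (hs : C ⊆ D) : Ch C :=
  fun a ha b hb => h a (hs ha) b (hs hb)

theorem exists_max {F : Finset P} (hF : Ch F) (hn : F.Nonempty) : ∃ a ∈ F, ∀ y ∈ F, y ≤ a := by
  obtain ⟨a, ha⟩ := F.exists_maximal hn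
  refine ⟨a, ha.1, fun y hy => ?_⟩
  rcases hF a ha.1 y hy with h | h
  · exact ha.2 hy h
  · exact h

theorem exists_min {F : Finset P} (hF : Ch F) (hn : F.Nonempty) : ∃ a ∈ F, ∀ y ∈ F, a ≤ y := by
  obtain ⟨a, ha⟩ := F.exists_minimal hn
  refine ⟨a, ha.1, fun y hy => ?_⟩
  rcases hF a ha.1 y hy with h | h
  · exact h
  · exact ha.2 hy h

theorem nonempty_of_odd {F : Finset P} (h : Odd F.card) : F.Nonempty := by
  rw [← Finset.card_pos]; exact h.pos

theorem odd_symmDiff (A B : Finset P) : Odd (symmDiff A B).card ↔ ¬ (Odd A.card ↔ Odd B.card) := by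
  have h1 : (symmDiff A B).card = (A \ B).card + (B \ A).card := by
    rw [symmDiff_def]
    exact Finset.card_union_of_disjoint disjoint_sdiff_sdiff
  have h2 := Finset.card_sdiff_add_card_inter A B
  have h3 := Finset.card_sdiff_add_card_inter B A
  rw [Finset.inter_comm] at h3
  simp only [Nat.odd_iff]
  omega

theorem S_symmDiff (A B : Finset P) (x : P) : S (symmDiff A B) x ↔ ¬ (S A x ↔ S B x) := by
  unfold S
  rw [← odd_symmDiff]
  have : (symmDiff A B).filter (fun y => y ≤ x)
      = symmDiff (A.filter fun y => y ≤ x) (B.filter fun y => y ≤ x) := by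
    ext y; simp only [Finset.mem_filter, Finset.mem_symmDiff]; tauto
  rw [this]

theorem S_empty (x : P) : ¬ S (∅ : Finset P) x := by simp [S]

theorem S_singleton (a x : P) : S {a} x ↔ a ≤ x := by
  unfold S
  by_cases h : a ≤ x <;> simp [Finset.filter_singleton, h]

theorem S_inj_empty {C : Finset P} (h : ∀ x, ¬ S C x) : C = ∅ := by
  by_contra hne
  obtain ⟨a, ha⟩ := C.exists_minimal (Finset.nonempty_iff_ne_empty.2 hne)
  apply h a
  have : C.filter (fun y => y ≤ a) = {a} := by
    ext y
    simp only [Finset.mem_filter, Finset.mem_singleton]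
    constructor
    · rintro ⟨h1, h2⟩; exact le_antisymm h2 (ha.2 h1 h2)
    · rintro rfl; exact ⟨ha.1, le_rfl⟩
  unfold S
  rw [this]; simp

theorem S_inj {C D : Finset P} (h : ∀ x, S C x ↔ S D x) : C = D := by
  have : symmDiff C D = ∅ := S_inj_empty fun x => by rw [S_symmDiff]; simpa using h x
  simpa using this

abbrev Pr (C : Finset P) (a b : P) : Prop := KalPairR (· ≤ ·) C a b

theorem pair_of_S {C : Finset P} (hC : Ch C) (he : Even C.card) {x : P} (hx : S C x) :
    ∃ a b, Pr C a b ∧ a ≤ x ∧ ¬ b ≤ x := by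
  obtain ⟨a, ha, hamax⟩ := exists_max (hC.mono (Finset.filter_subset (fun y => y ≤ x) C))
    (nonempty_of_odd hx)
  have hcard := Finset.card_filter_add_card_filter_not (s := C) (fun y => y ≤ x)
  have hodd : Odd (C.filter fun y => ¬ y ≤ x).card := by
    unfold S at hx
    rw [Nat.odd_iff] at *; rw [Nat.even_iff] at he; omega
  obtain ⟨b, hb, hbmin⟩ := exists_min (hC.mono (Finset.filter_subset (fun y => ¬ y ≤ x) C))
    (nonempty_of_odd hodd)
  simp only [Finset.mem_filter] at ha hb hamax hbmin
  refine ⟨a, b, ⟨ha.1, hb.1, ?_, ?_, ?_, ?_⟩, ha.2, hb.2⟩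
  · rcases hC a ha.1 b hb.1 with h | h
    · exact h
    · exact absurd (h.trans ha.2) hb.2
  · rintro rfl; exact hb.2 ha.2
  · have : C.filter (fun y => y ≤ a) = C.filter (fun y => y ≤ x) := by
      ext y
      simp only [Finset.mem_filter]
      exact ⟨fun h => ⟨h.1, h.2.trans ha.2⟩, fun h => ⟨h.1, hamax y h⟩⟩
    rw [this]; exact hx
  · intro c hc hac hne
    apply hbmin c ⟨hc, fun hcx => hne (le_antisymm (hamax c ⟨hc, hcx⟩) hac)⟩

theorem S_of_pair {C : Finset P} (hC : Ch C) {a b x : P} (h : Pr C a b) (hax : a ≤ x)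
    (hbx : ¬ b ≤ x) : S C x := by
  obtain ⟨ha, hb, hab, hne, ho, hs⟩ := h
  have : C.filter (fun y => y ≤ x) = C.filter (fun y => y ≤ a) := by
    ext y
    simp only [Finset.mem_filter]
    refine ⟨fun h => ⟨h.1, ?_⟩, fun h => ⟨h.1, h.2.trans hax⟩⟩
    rcases hC y h.1 a ha with h' | h'
    · exact h'
    · by_cases hya : y = a
      · exact hya.le
      · exact absurd ((hs y h.1 h' hya).trans h.2) hbx
  unfold S
  rw [this]; exact ho

theorem not_S_of_pair {C : Finset P} (hC : Ch C) {a b : P} (h : Pr C a b) : ¬ S C b := by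
  obtain ⟨ha, hb, hab, hne, ho, hs⟩ := h
  have hba : ¬ b ≤ a := fun h => hne (le_antisymm hab h)
  have : C.filter (fun y => y ≤ b) = insert b (C.filter (fun y => y ≤ a)) := by
    ext y
    simp only [Finset.mem_filter, Finset.mem_insert]
    constructor
    · rintro ⟨h1, h2⟩
      rcases hC y h1 a ha with h' | h'
      · exact Or.inr ⟨h1, h'⟩
      · by_cases hya : y = a
        · exact Or.inr ⟨h1, hya.le⟩
        · exact Or.inl (le_antisymm h2 (hs y h1 h' hya))
    · rintro (rfl | h)
      · exact ⟨hb, le_rfl⟩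
      · exact ⟨h.1, h.2.trans hab⟩
  unfold S
  have ho : Odd (C.filter (fun y => y ≤ a)).card := ho
  rw [this, Finset.card_insert_of_notMem (by simp [hba])]
  rw [Nat.odd_iff] at *
  omega

theorem mem_pair {C : Finset P} (hC : Ch C) (he : Even C.card) {c : P} (hc : c ∈ C) :
    ∃ a b, Pr C a b ∧ a ≤ c ∧ c ≤ b := by
  by_cases hS : S C c
  · obtain ⟨a, b, h, h1, h2⟩ := pair_of_S hC he hS
    refine ⟨a, b, h, h1, ?_⟩
    rcases hC c hc b h.2.1 with h' | h'
    · exact h'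
    · exact absurd h' h2
  · have hins : C.filter (fun y => y ≤ c) = insert c (C.filter (fun y => y < c)) := by
      ext y
      simp only [Finset.mem_filter, Finset.mem_insert, le_iff_eq_or_lt]
      constructor
      · tauto
      · rintro (rfl | h)
        · exact ⟨hc, Or.inl rfl⟩
        · tauto
    have hodd : Odd (C.filter (fun y => y < c)).card := by
      unfold S at hS
      rw [hins, Finset.card_insert_of_notMem (by simp)] at hS
      rw [Nat.odd_iff] at *
      omega
    obtain ⟨a, ha, hamax⟩ := exists_max (hC.mono (Finset.filter_subset (fun y => y < c) C))
      (nonempty_of_odd hodd)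
    simp only [Finset.mem_filter] at ha hamax
    refine ⟨a, c, ⟨ha.1, hc, ha.2.le, ha.2.ne, ?_, ?_⟩, ha.2.le, le_rfl⟩
    · have : C.filter (fun y => y ≤ a) = C.filter (fun y => y < c) := by
        ext y
        simp only [Finset.mem_filter]
        exact ⟨fun h => ⟨h.1, h.2.trans_lt ha.2⟩, fun h => ⟨h.1, hamax y h⟩⟩
      rw [this]; exact hodd
    · intro d hd had hne
      rcases hC d hd c hc with h' | h'
      · by_cases hdc : d = c
        · exact hdc.ge
        · exact absurd (le_antisymm (hamax d ⟨hd, lt_of_le_of_ne h' hdc⟩) had) hne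
      · exact h'

theorem Ch_union {C D : Finset P} (hC : Ch C) (hD : Ch D)
    (h : ∀ c ∈ C, ∀ d ∈ D, c ≤ d ∨ d ≤ c) : Ch (C ∪ D) := by
  intro a ha b hb
  rcases Finset.mem_union.1 ha with ha | ha <;> rcases Finset.mem_union.1 hb with hb | hb
  · exact hC a ha b hb
  · exact h a ha b hb
  · exact (h b hb a ha).symm
  · exact hD a ha b hb

theorem le_iff {C D : Finset P} (hC : Ch C) (hCe : Even C.card) (hD : Ch D) (hDe : Even D.card) :
    KalLER (· ≤ ·) C D ↔ Ch (C ∪ D) ∧ ∀ x, S C x → S D x := by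
  constructor
  · intro h
    refine ⟨Ch_union hC hD ?_, ?_⟩
    · intro c hc d hd
      obtain ⟨a, b, hp, hac, hcb⟩ := mem_pair hC hCe hc
      obtain ⟨p, q, hpq, hpa, hbq⟩ := h a b hp
      rcases hD d hd p hpq.1 with h' | h'
      · exact Or.inr (h'.trans (hpa.trans hac))
      · by_cases hdp : d = p
        · exact Or.inr (hdp.le.trans (hpa.trans hac))
        · exact Or.inl (hcb.trans (hbq.trans (hpq.2.2.2.2.2 d hd h' hdp)))
    · intro x hx
      obtain ⟨a, b, hp, hax, hbx⟩ := pair_of_S hC hCe hx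
      obtain ⟨p, q, hpq, hpa, hbq⟩ := h a b hp
      exact S_of_pair hD hpq (hpa.trans hax) (fun hq => hbx (hbq.trans hq))
  · rintro ⟨hU, hS⟩ a b hp
    have haS : S C a := hp.2.2.2.2.1
    obtain ⟨p, q, hpq, hpa, hqa⟩ := pair_of_S hD hDe (hS a haS)
    refine ⟨p, q, hpq, hpa, ?_⟩
    by_contra hbq
    have haq : a ≤ q := by
      rcases hU a (Finset.mem_union_left _ hp.1) q (Finset.mem_union_right _ hpq.2.1) with h | h
      · exact h
      · exact absurd h hqa
    exact not_S_of_pair hD hpq (hS q (S_of_pair hC hp haq hbq))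

abbrev K (P : Type u) [PartialOrder P] : Set (Finset P) :=
  KalCarrier Set.univ ((· ≤ ·) : P → P → Prop)

theorem mem_K {C : Finset P} : C ∈ K P ↔ Ch C ∧ Even C.card := by
  simp [KalCarrier, IsEvenChainR, Ch]

theorem K_le_iff {C D : Finset P} (hC : C ∈ K P) (hD : D ∈ K P) :
    KalLER (· ≤ ·) C D ↔ Ch (C ∪ D) ∧ ∀ x, S C x → S D x :=
  le_iff (mem_K.1 hC).1 (mem_K.1 hC).2 (mem_K.1 hD).1 (mem_K.1 hD).2

theorem symmDiff_sub (C D : Finset P) : symmDiff C D ⊆ C ∪ D := by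
  intro x; simp only [Finset.mem_symmDiff, Finset.mem_union]; tauto

theorem symmDiff_mem {C D : Finset P} (hC : C ∈ K P) (hD : D ∈ K P) (h : Ch (C ∪ D)) :
    symmDiff C D ∈ K P := by
  rw [mem_K] at *
  refine ⟨h.mono (symmDiff_sub C D), ?_⟩
  have := odd_symmDiff C D
  simp only [← Nat.not_even_iff_odd] at this
  have h1 := hC.2
  have h2 := hD.2
  tauto

theorem lub {C D : Finset P} (hC : C ∈ K P) (hD : D ∈ K P) (h : Ch (C ∪ D))
    (hdis : ∀ x, S C x → ¬ S D x) :
    RelLUB (K P) (KalLER (· ≤ ·)) C D (symmDiff C D) := by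
  have hm := symmDiff_mem hC hD h
  refine ⟨hm, ?_, ?_, ?_⟩
  · rw [K_le_iff hC hm]
    refine ⟨h.mono (Finset.union_subset Finset.subset_union_left (symmDiff_sub C D)), ?_⟩
    intro x hx; rw [S_symmDiff]; have := hdis x; tauto
  · rw [K_le_iff hD hm]
    refine ⟨h.mono (Finset.union_subset Finset.subset_union_right (symmDiff_sub C D)), ?_⟩
    intro x hx; rw [S_symmDiff]; have := hdis x; tauto
  · intro W hW h1 h2
    rw [K_le_iff hC hW] at h1
    rw [K_le_iff hD hW] at h2
    rw [K_le_iff hm hW]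
    refine ⟨Ch_union (mem_K.1 hm).1 (mem_K.1 hW).1 ?_, ?_⟩
    · intro c hc d hd
      rcases Finset.mem_union.1 (symmDiff_sub C D hc) with h' | h'
      · exact h1.1 c (Finset.mem_union_left _ h') d (Finset.mem_union_right _ hd)
      · exact h2.1 c (Finset.mem_union_left _ h') d (Finset.mem_union_right _ hd)
    · intro x hx
      rw [S_symmDiff] at hx
      have := h1.2 x
      have := h2.2 x
      tauto

theorem empty_mem : (∅ : Finset P) ∈ K P := by
  rw [mem_K]; exact ⟨by intro a ha; simp at ha, by simp⟩

variable [BoundedOrder P]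

theorem eta_eq (a : P) : kalEtaF ⊥ a = symmDiff {(⊥ : P)} {a} := by
  unfold kalEtaF
  split_ifs with h
  · simp [h]
  · ext y
    simp only [Finset.mem_insert, Finset.mem_singleton, Finset.mem_symmDiff]
    have : y = ⊥ → y ≠ a := by rintro rfl h'; exact h h'.symm
    tauto

theorem S_eta (a x : P) : S (kalEtaF ⊥ a) x ↔ ¬ a ≤ x := by
  rw [eta_eq, S_symmDiff, S_singleton, S_singleton]; simp

theorem eta_sub (a : P) : kalEtaF ⊥ a ⊆ {⊥, a} := by
  unfold kalEtaF; split_ifs <;> simp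

theorem eta_mem (a : P) : kalEtaF ⊥ a ∈ K P := by
  rw [mem_K]
  constructor
  · refine Ch.mono ?_ (eta_sub a)
    intro x hx y hy
    simp only [Finset.mem_insert, Finset.mem_singleton] at hx hy
    rcases hx with rfl | rfl <;> rcases hy with rfl | rfl <;> simp
  · rw [eta_eq, ← Nat.not_odd_iff_even, odd_symmDiff]; simp

theorem eta_le (a b : P) : a ≤ b ↔ KalLER (· ≤ ·) (kalEtaF ⊥ a) (kalEtaF ⊥ b) := by
  rw [K_le_iff (eta_mem a) (eta_mem b)]
  simp only [S_eta]
  constructor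
  · intro h
    refine ⟨Ch_union (mem_K.1 (eta_mem a)).1 (mem_K.1 (eta_mem b)).1 ?_, 
      fun x hx hb => hx (h.trans hb)⟩
    intro x hx y hy
    have hx := eta_sub a hx
    have hy := eta_sub b hy
    simp only [Finset.mem_insert, Finset.mem_singleton] at hx hy
    rcases hx with rfl | rfl <;> rcases hy with rfl | rfl <;> simp [h]
  · rintro ⟨-, h⟩
    by_contra hab
    exact h b hab le_rfl

variable [Nontrivial P]

theorem eta_top : kalEtaF (⊥ : P) ⊤ = {⊥, ⊤} := by simp [kalEtaF]

theorem S_T (x : P) : S ({⊥, ⊤} : Finset P) x ↔ x ≠ ⊤ := by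
  rw [← eta_top, S_eta, top_le_iff]

theorem T_mem : ({⊥, ⊤} : Finset P) ∈ K P := by rw [← eta_top]; exact eta_mem ⊤

theorem Ch_T {C : Finset P} (h : Ch C) : Ch (C ∪ {⊥, ⊤}) := by
  refine Ch_union h (mem_K.1 T_mem).1 ?_
  intro c _ d hd
  simp only [Finset.mem_insert, Finset.mem_singleton] at hd
  rcases hd with rfl | rfl <;> simp

theorem S_top {C : Finset P} (h : C ∈ K P) : ¬ S C ⊤ := by
  have := (mem_K.1 h).2
  simpa [S] using this

theorem compl_mem {C : Finset P} (h : C ∈ K P) : kalComplF ⊥ ⊤ C ∈ K P :=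
  symmDiff_mem h T_mem (Ch_T (mem_K.1 h).1)

theorem S_compl (C : Finset P) (x : P) : S (kalComplF ⊥ ⊤ C) x ↔ ¬ (S C x ↔ x ≠ ⊤) := by
  unfold kalComplF
  rw [S_symmDiff, S_T]

theorem compl_sub (C : Finset P) : kalComplF ⊥ ⊤ C ⊆ C ∪ {⊥, ⊤} := symmDiff_sub _ _

theorem compl_compl' (C : Finset P) : kalComplF ⊥ ⊤ (kalComplF ⊥ ⊤ C) = C := by
  unfold kalComplF
  exact symmDiff_symmDiff_cancel_right _ _

theorem Ch_compl {C D : Finset P} (h : Ch (C ∪ D)) : Ch (C ∪ kalComplF ⊥ ⊤ D) := by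
  refine (Ch_T h).mono ?_
  rw [Finset.union_assoc]
  exact Finset.union_subset_union_right (compl_sub D)

theorem Ch_comm {C D : Finset P} (h : Ch (C ∪ D)) : Ch (D ∪ C) := by
  rwa [Finset.union_comm]

theorem orthomod : IsOrthomodularPosetOn (K P)
      (KalLER (· ≤ ·)) (kalComplF (⊥ : P) ⊤) (∅ : Finset P) ({⊥, ⊤} : Finset P) where
  bot_mem := empty_mem
  top_mem := T_mem
  compl_mem := fun x hx => compl_mem hx
  refl := fun x _ a b h => ⟨a, b, h, le_rfl, le_rfl⟩
  antisymm := fun x hx y hy h1 h2 => by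
    rw [K_le_iff hx hy] at h1
    rw [K_le_iff hy hx] at h2
    exact S_inj fun t => ⟨h1.2 t, h2.2 t⟩
  trans := fun x _ y _ w _ h1 h2 a b h => by
    obtain ⟨c, d, h', hc, hd⟩ := h1 a b h
    obtain ⟨e, f, h'', he, hf⟩ := h2 c d h'
    exact ⟨e, f, h'', le_trans he hc, le_trans hd hf⟩
  bot_le := fun x _ a b h => by simpa using h.1
  le_top := fun x hx => by
    rw [K_le_iff hx T_mem]
    refine ⟨Ch_T (mem_K.1 hx).1, fun t ht => ?_⟩
    rw [S_T]
    rintro rfl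
    exact S_top hx ht
  compl_anti := fun x hx y hy h => by
    rw [K_le_iff hx hy] at h
    rw [K_le_iff (compl_mem hy) (compl_mem hx)]
    refine ⟨Ch_compl (Ch_comm (Ch_compl h.1)), fun t => ?_⟩
    rw [S_compl, S_compl]
    have := h.2 t
    have h1 : t = ⊤ → ¬ S y t := by rintro rfl; exact S_top hy
    tauto
  compl_compl := fun x _ => compl_compl' x
  inf_compl := fun x hx => by
    refine ⟨empty_mem, fun a b h => by simpa using h.1, fun a b h => by simpa using h.1, ?_⟩
    intro w hw h1 h2
    rw [K_le_iff hw hx] at h1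
    rw [K_le_iff hw (compl_mem hx)] at h2
    have : w = ∅ := S_inj_empty fun t ht => by
      have h3 := h1.2 t ht
      have h4 := h2.2 t ht
      rw [S_compl] at h4
      have h5 : t = ⊤ → ¬ S x t := by rintro rfl; exact S_top hx
      tauto
    rw [this]
    exact fun a b h => ⟨a, b, h, le_rfl, le_rfl⟩
  sup_of_orth := fun x hx y hy h => by
    rw [K_le_iff hx (compl_mem hy)] at h
    refine ⟨_, lub hx hy ?_ ?_⟩
    · have := Ch_compl h.1
      rwa [compl_compl'] at this
    · intro t ht
      have h4 := h.2 t ht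
      rw [S_compl] at h4
      have h5 : t = ⊤ → ¬ S x t := by rintro rfl; exact S_top hx
      tauto
  orthomodular := fun x hx y hy h => by
    rw [K_le_iff hx hy] at h
    refine ⟨symmDiff x (kalComplF ⊥ ⊤ y), lub hx (compl_mem hy) (Ch_compl h.1) ?_, ?_⟩
    · intro t ht
      rw [S_compl]
      have := h.2 t ht
      have h5 : t = ⊤ → ¬ S x t := by rintro rfl; exact S_top hx
      tauto
    · have e : kalComplF ⊥ ⊤ (symmDiff x (kalComplF ⊥ ⊤ y)) = symmDiff x y := by
        unfold kalComplF
        rw [symmDiff_assoc, symmDiff_symmDiff_cancel_right]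
      have e2 : symmDiff x (symmDiff x y) = y := symmDiff_symmDiff_cancel_left _ _
      rw [e]
      have := lub hx (symmDiff_mem hx hy h.1)
        (h.1.mono (Finset.union_subset Finset.subset_union_left (symmDiff_sub x y)))
        (fun t ht => by rw [S_symmDiff]; have := h.2 t ht; tauto)
      rwa [e2] at this

end KalAux

/-- The map `η_P : P → K(P)`, `η_P 0 = ∅`, `η_P a = [0 < a]` for
`a > 0`, is an order embedding of bounded posets: it sends `0` to the bottom and `1`
to the top of `K(P)`, and `a ≤ b` iff `η_P a ≤ η_P b`.  Hence every bounded poset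
embeds into an orthomodular poset, namely its Kalmbach extension. -/
theorem kalmbach_unit_order_embedding
    (P : Type u) [PartialOrder P] [BoundedOrder P] [Nontrivial P] :
    (∀ a : P, kalEtaF ⊥ a ∈ KalCarrier Set.univ ((· ≤ ·) : P → P → Prop)) ∧
    kalEtaF (⊥ : P) ⊥ = (∅ : Finset P) ∧
    kalEtaF (⊥ : P) ⊤ = ({⊥, ⊤} : Finset P) ∧
    (∀ a b : P, a ≤ b ↔ KalLER (· ≤ ·) (kalEtaF ⊥ a) (kalEtaF ⊥ b)) ∧
    IsOrthomodularPosetOn (KalCarrier Set.univ ((· ≤ ·) : P → P → Prop))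
      (KalLER (· ≤ ·)) (kalComplF (⊥ : P) ⊤) (∅ : Finset P) ({⊥, ⊤} : Finset P) := by
  exact ⟨KalAux.eta_mem, by simp [kalEtaF], KalAux.eta_top, KalAux.eta_le, KalAux.orthomod⟩
end

section
/- If L is a bounded lattice, then the Kalmbach extension K(L) is a lattice, and (K(L),∧,∨,⊥,∅,{0,1}) is an orthomodular lattice; consequently every bounded lattice embeds into an orthomodular lattice. -/
attribute [local instance] Classical.propDecidable

universe u v w

section KalHelpers

variable {L : Type u} [Lattice L]

/-- chain condition -/
def KH.Ch (C : Finset L) : Prop := ∀ a ∈ C, ∀ b ∈ C, a ≤ b ∨ b ≤ a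

/-- pair -/
def KH.P (C : Finset L) (a b : L) : Prop := KalPairR (· ≤ ·) C a b

/-- number of elements below -/
noncomputable def KH.N (C : Finset L) (a : L) : ℕ := (C.filter fun y => y ≤ a).card

namespace KH

theorem P_iff (C : Finset L) (a b : L) : P C a b ↔
    a ∈ C ∧ b ∈ C ∧ a < b ∧ Odd (N C a) ∧ ∀ c ∈ C, a < c → b ≤ c := by
  constructor
  · rintro ⟨h1, h2, h3, h4, h5, h6⟩
    exact ⟨h1, h2, lt_of_le_of_ne h3 h4, h5, fun c hc h => h6 c hc h.le h.ne'⟩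
  · rintro ⟨h1, h2, h3, h5, h6⟩
    exact ⟨h1, h2, h3.le, h3.ne, h5, fun c hc h h' => h6 c hc (lt_of_le_of_ne h (Ne.symm h'))⟩

theorem mem_K (C : Finset L) :
    C ∈ KalCarrier Set.univ ((· ≤ ·) : L → L → Prop) ↔ Ch C ∧ Even C.card :=
  ⟨fun h => h.2, fun h => ⟨Set.subset_univ _, h⟩⟩

theorem le_iff (C D : Finset L) : KalLER (· ≤ ·) C D ↔
    ∀ a b, P C a b → ∃ c d, P D c d ∧ c ≤ a ∧ b ≤ d := Iff.rfl

theorem least (F : Finset L) (hn : F.Nonempty) (hF : Ch F) : ∃ m ∈ F, ∀ x ∈ F, m ≤ x := by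
  obtain ⟨m, hm⟩ := F.exists_minimal hn
  refine ⟨m, hm.1, fun x hx => ?_⟩
  rcases hF m hm.1 x hx with h | h
  · exact h
  · exact hm.2 hx h

theorem greatest (F : Finset L) (hn : F.Nonempty) (hF : Ch F) : ∃ m ∈ F, ∀ x ∈ F, x ≤ m := by
  obtain ⟨m, hm⟩ := F.exists_maximal hn
  refine ⟨m, hm.1, fun x hx => ?_⟩
  rcases hF m hm.1 x hx with h | h
  · exact hm.2 hx h
  · exact h

theorem Ch.filter {C : Finset L} (h : Ch C) (p : L → Prop) : Ch (C.filter p) :=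
  fun a ha b hb => h a (Finset.mem_filter.1 ha).1 b (Finset.mem_filter.1 hb).1

theorem N_succ {C : Finset L} (hC : Ch C) {a b : L} (hb : b ∈ C) (hab : a < b) (ha : a ∈ C)
    (h : ∀ c ∈ C, a < c → b ≤ c) : N C b = N C a + 1 := by
  unfold N
  have : C.filter (fun y => y ≤ b) = insert b (C.filter fun y => y ≤ a) := by
    ext y
    simp only [Finset.mem_filter, Finset.mem_insert]
    constructor
    · rintro ⟨hy, hyb⟩
      by_cases hya : y ≤ a
      · exact Or.inr ⟨hy, hya⟩
      · left
        have : a < y := lt_of_le_not_ge ((hC y hy a ha).resolve_left hya) hya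
        exact le_antisymm hyb (h y hy this)
    · rintro (rfl | ⟨hy, hya⟩)
      · exact ⟨hb, le_rfl⟩
      · exact ⟨hy, hya.trans hab.le⟩
  rw [this, Finset.card_insert_of_notMem]
  simp only [Finset.mem_filter, not_and]
  intro _ h'
  exact absurd (lt_of_lt_of_le hab h') (lt_irrefl _)

theorem P_even {C : Finset L} (hC : Ch C) {a b : L} (h : P C a b) : Even (N C b) := by
  rw [P_iff] at h
  rw [N_succ hC h.2.1 h.2.2.1 h.1 h.2.2.2.2]
  exact h.2.2.2.1.add_one

theorem exists_right {C : Finset L} (hC : Ch C) (he : Even C.card) {a : L} (ha : a ∈ C)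
    (ho : Odd (N C a)) : ∃ b, P C a b := by
  have hn : (C.filter fun y => a < y).Nonempty := by
    by_contra hne
    rw [Finset.not_nonempty_iff_eq_empty] at hne
    have : C.filter (fun y => y ≤ a) = C := by
      rw [Finset.filter_eq_self]
      intro y hy
      rcases hC y hy a ha with h | h
      · exact h
      · by_contra h'
        have : y ∈ C.filter fun y => a < y := Finset.mem_filter.2 ⟨hy, lt_of_le_not_ge h h'⟩
        rw [hne] at this
        simp at this
    unfold N at ho
    rw [this] at ho
    exact (Nat.not_even_iff_odd.2 ho) he
  obtain ⟨b, hb, hm⟩ := least _ hn (hC.filter _)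
  rw [Finset.mem_filter] at hb
  refine ⟨b, (P_iff _ _ _).2 ⟨ha, hb.1, hb.2, ho, fun c hc hac => hm c ?_⟩⟩
  exact Finset.mem_filter.2 ⟨hc, hac⟩

theorem exists_left {C : Finset L} (hC : Ch C) {b : L} (hb : b ∈ C)
    (ho : Even (N C b)) : ∃ a, P C a b := by
  have hn : (C.filter fun y => y < b).Nonempty := by
    by_contra hne
    rw [Finset.not_nonempty_iff_eq_empty] at hne
    have : C.filter (fun y => y ≤ b) = {b} := by
      ext y
      simp only [Finset.mem_filter, Finset.mem_singleton]
      constructor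
      · rintro ⟨hy, h⟩
        by_contra h'
        have : y ∈ C.filter fun y => y < b := Finset.mem_filter.2 ⟨hy, lt_of_le_of_ne h h'⟩
        rw [hne] at this
        simp at this
      · rintro rfl
        exact ⟨hb, le_rfl⟩
    unfold N at ho
    rw [this] at ho
    simp at ho
  obtain ⟨a, ha, hm⟩ := greatest _ hn (hC.filter _)
  rw [Finset.mem_filter] at ha
  have hs : ∀ c ∈ C, a < c → b ≤ c := by
    intro c hc hac
    rcases hC b hb c hc with h | h
    · exact h
    · by_contra h'
      have := hm c (Finset.mem_filter.2 ⟨hc, lt_of_le_not_ge h h'⟩)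
      exact absurd (lt_of_lt_of_le hac this) (lt_irrefl _)
  refine ⟨a, (P_iff _ _ _).2 ⟨ha.1, hb, ha.2, ?_, hs⟩⟩
  rw [N_succ hC hb ha.2 ha.1 hs] at ho
  rcases Nat.even_or_odd (N C a) with h | h
  · exact absurd ho (Nat.not_even_iff_odd.2 h.add_one)
  · exact h

theorem P_lt {C : Finset L} {a b : L} (h : P C a b) : a < b := ((P_iff _ _ _).1 h).2.2.1

theorem P_disj {C : Finset L} (hC : Ch C) {a b c d : L} (h : P C a b) (h' : P C c d) :
    (a = c ∧ b = d) ∨ b < c ∨ d < a := by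
  have e1 := P_even hC h
  have e2 := P_even hC h'
  rw [P_iff] at h h'
  obtain ⟨h1, h2, h3, h4, h5⟩ := h
  obtain ⟨k1, k2, k3, k4, k5⟩ := h'
  by_cases hac : a = c
  · subst hac
    exact Or.inl ⟨rfl, le_antisymm (h5 d k2 k3) (k5 b h2 h3)⟩
  · right
    rcases hC a h1 c k1 with h | h
    · left
      refine lt_of_le_of_ne (h5 c k1 (lt_of_le_of_ne h hac)) ?_
      rintro rfl
      exact (Nat.not_even_iff_odd.2 k4) e1
    · right
      refine lt_of_le_of_ne (k5 a h1 (lt_of_le_of_ne h (Ne.symm hac))) ?_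
      rintro rfl
      exact (Nat.not_even_iff_odd.2 h4) e2

/-- a nondegenerate interval inside two pairs forces equality -/
theorem P_eq {C : Finset L} (hC : Ch C) {a b c d x y : L} (h : P C a b) (h' : P C c d)
    (hxy : x < y) (h1 : a ≤ x) (h2 : y ≤ b) (h3 : c ≤ x) (h4 : y ≤ d) : a = c ∧ b = d := by
  rcases P_disj hC h h' with h | h | h
  · exact h
  · exact absurd (hxy.trans_le (h2.trans (h.le.trans h3))) (lt_irrefl _)
  · exact absurd (hxy.trans_le (h4.trans (h.le.trans h1))) (lt_irrefl _)

theorem mem_iff {C : Finset L} (hC : Ch C) (he : Even C.card) (x : L) :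
    x ∈ C ↔ ∃ a b, P C a b ∧ (x = a ∨ x = b) := by
  constructor
  · intro hx
    rcases Nat.even_or_odd (N C x) with h | h
    · obtain ⟨a, ha⟩ := exists_left hC hx h
      exact ⟨a, x, ha, Or.inr rfl⟩
    · obtain ⟨b, hb⟩ := exists_right hC he hx h
      exact ⟨x, b, hb, Or.inl rfl⟩
  · rintro ⟨a, b, h, rfl | rfl⟩
    · exact h.1
    · exact h.2.1

/-- construction of an even chain from a finite set of pairs -/
theorem build (S : Finset (L × L)) (h1 : ∀ s ∈ S, s.1 < s.2)
    (h2 : ∀ s ∈ S, ∀ t ∈ S, s = t ∨ s.2 < t.1 ∨ t.2 < s.1) :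
    ∃ M : Finset L, (∀ x, x ∈ M ↔ ∃ s ∈ S, x = s.1 ∨ x = s.2) ∧ Ch M ∧ Even M.card ∧
      ∀ a b, P M a b ↔ (a, b) ∈ S := by
  have hne : ∀ s ∈ S, ∀ t ∈ S, s.1 ≠ t.2 := by
    intro s hs t ht h
    have a1 := h1 s hs
    have a2 := h1 t ht
    rcases h2 s hs t ht with rfl | h' | h'
    · exact a1.ne h
    · exact absurd ((a1.trans h').trans a2) (by rw [h]; exact lt_irrefl _)
    · exact h'.ne h.symm
  have inj1 : ∀ s ∈ S, ∀ t ∈ S, s.1 = t.1 → s = t := by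
    intro s hs t ht h
    have a1 := h1 s hs
    have a2 := h1 t ht
    rcases h2 s hs t ht with rfl | h' | h'
    · rfl
    · exact absurd (a1.trans h') (by rw [h]; exact lt_irrefl _)
    · exact absurd (a2.trans h') (by rw [h]; exact lt_irrefl _)
  have inj2 : ∀ s ∈ S, ∀ t ∈ S, s.2 = t.2 → s = t := by
    intro s hs t ht h
    have a1 := h1 s hs
    have a2 := h1 t ht
    rcases h2 s hs t ht with rfl | h' | h'
    · rfl
    · exact absurd (h'.trans a2) (by rw [h]; exact lt_irrefl _)
    · exact absurd (h'.trans a1) (by rw [h]; exact lt_irrefl _)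
  have hcard : ∀ A ⊆ S, ∀ B ⊆ S,
      (A.image Prod.fst ∪ B.image Prod.snd).card = A.card + B.card := by
    intro A hA B hB
    rw [Finset.card_union_of_disjoint, Finset.card_image_of_injOn, Finset.card_image_of_injOn]
    · intro s hs t ht h
      exact inj2 s (hB hs) t (hB ht) h
    · intro s hs t ht h
      exact inj1 s (hA hs) t (hA ht) h
    · rw [Finset.disjoint_left]
      intro x hx hx'
      obtain ⟨s, hs, rfl⟩ := Finset.mem_image.1 hx
      obtain ⟨t, ht, h⟩ := Finset.mem_image.1 hx'
      exact hne s (hA hs) t (hB ht) h.symm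
  set M : Finset L := S.image Prod.fst ∪ S.image Prod.snd with hM
  have hmem : ∀ x, x ∈ M ↔ ∃ s ∈ S, x = s.1 ∨ x = s.2 := by
    intro x
    simp only [hM, Finset.mem_union, Finset.mem_image]
    constructor
    · rintro (⟨s, hs, rfl⟩ | ⟨s, hs, rfl⟩)
      · exact ⟨s, hs, Or.inl rfl⟩
      · exact ⟨s, hs, Or.inr rfl⟩
    · rintro ⟨s, hs, rfl | rfl⟩
      · exact Or.inl ⟨s, hs, rfl⟩
      · exact Or.inr ⟨s, hs, rfl⟩
  have hCh : Ch M := by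
    intro x hx y hy
    rw [hmem] at hx hy
    obtain ⟨s, hs, hxs⟩ := hx
    obtain ⟨t, ht, hyt⟩ := hy
    have a1 := (h1 s hs).le
    have a2 := (h1 t ht).le
    rcases h2 s hs t ht with rfl | h | h
    · rcases hxs with rfl | rfl <;> rcases hyt with rfl | rfl <;> simp [a1]
    · left
      have e1 : x ≤ s.2 := by rcases hxs with rfl | rfl <;> simp [a1]
      have e2 : t.1 ≤ y := by rcases hyt with rfl | rfl <;> simp [a2]
      exact e1.trans (h.le.trans e2)
    · right
      have e1 : s.1 ≤ x := by rcases hxs with rfl | rfl <;> simp [a1]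
      have e2 : y ≤ t.2 := by rcases hyt with rfl | rfl <;> simp [a2]
      exact e2.trans (h.le.trans e1)
  have hN : ∀ s ∈ S, Odd (N M s.1) := by
    intro s hs
    have e : M.filter (fun y => y ≤ s.1) =
        (S.filter fun t => t.1 ≤ s.1).image Prod.fst ∪
          (S.filter fun t => t.2 ≤ s.1).image Prod.snd := by
      rw [hM, Finset.filter_union, Finset.filter_image, Finset.filter_image]
    have e2 : (S.filter fun t => t.1 ≤ s.1) = insert s (S.filter fun t => t.2 ≤ s.1) := by
      ext t
      simp only [Finset.mem_filter, Finset.mem_insert]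
      constructor
      · rintro ⟨ht, hle⟩
        rcases h2 s hs t ht with rfl | h | h
        · exact Or.inl rfl
        · exact absurd (((h1 s hs).trans h).trans_le hle) (lt_irrefl _)
        · exact Or.inr ⟨ht, h.le⟩
      · rintro (rfl | ⟨ht, hle⟩)
        · exact ⟨hs, le_rfl⟩
        · exact ⟨ht, (h1 t ht).le.trans hle⟩
    unfold N
    rw [e, hcard _ (Finset.filter_subset _ _) _ (Finset.filter_subset _ _), e2,
      Finset.card_insert_of_notMem]
    · exact ⟨_, by ring⟩
    · simp only [Finset.mem_filter, not_and]
      intro _ h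
      exact absurd ((h1 s hs).trans_le h) (lt_irrefl _)
  have hP : ∀ s ∈ S, P M s.1 s.2 := by
    intro s hs
    refine (P_iff _ _ _).2 ⟨(hmem _).2 ⟨s, hs, Or.inl rfl⟩, (hmem _).2 ⟨s, hs, Or.inr rfl⟩,
      h1 s hs, hN s hs, ?_⟩
    intro c hc hsc
    obtain ⟨t, ht, hct⟩ := (hmem _).1 hc
    have a2 := h1 t ht
    rcases h2 s hs t ht with rfl | h | h
    · rcases hct with rfl | rfl
      · exact absurd hsc (lt_irrefl _)
      · exact le_rfl
    · rcases hct with rfl | rfl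
      · exact h.le
      · exact (h.trans a2).le
    · exfalso
      have : c ≤ t.2 := by rcases hct with rfl | rfl <;> simp [a2.le]
      exact absurd (hsc.trans_le (this.trans h.le)) (lt_irrefl _)
  refine ⟨M, hmem, hCh, ?_, ?_⟩
  · rw [hM, hcard S subset_rfl S subset_rfl]
    exact ⟨_, rfl⟩
  · intro a b
    constructor
    · intro h
      obtain ⟨s, hs, rfl | rfl⟩ := (hmem a).1 h.1
      · have hs' := hP s hs
        rcases P_disj hCh h hs' with h' | h' | h'
        · rw [h'.2]; exact hs
        · exact absurd (h'.trans (P_lt h)) (lt_irrefl _)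
        · exact absurd (h'.trans (P_lt hs')) (lt_irrefl _)
      · exact absurd (P_even hCh (hP s hs)) (Nat.not_even_iff_odd.2 ((P_iff _ _ _).1 h).2.2.2.1)
    · exact fun h => hP _ h

theorem even_card_symmDiff (s t : Finset L) :
    Even (symmDiff s t).card ↔ (Even s.card ↔ Even t.card) := by
  have h1 : (symmDiff s t).card = (s \ t).card + (t \ s).card := by
    rw [symmDiff_def, Finset.sup_eq_union, Finset.card_union_of_disjoint]
    exact disjoint_sdiff_sdiff
  have h2 := Finset.card_sdiff_add_card_inter s t
  have h3 := Finset.card_sdiff_add_card_inter t s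
  rw [Finset.inter_comm t s] at h3
  rw [h1, ← h2, ← h3]
  simp only [Nat.even_add]
  tauto

/-- meets -/
theorem exists_meet {C D : Finset L} (hC : Ch C) (eC : Even C.card) (hD : Ch D)
    (eD : Even D.card) :
    ∃ M, RelGLB (KalCarrier Set.univ ((· ≤ ·) : L → L → Prop)) (KalLER (· ≤ ·)) C D M := by
  have hfin : ({s : L × L | s.1 < s.2 ∧ ∃ a b c d, P C a b ∧ P D c d ∧ s.1 = a ⊔ c ∧
      s.2 = b ⊓ d}).Finite := by
    apply ((Finset.finite_toSet ((C ×ˢ C) ×ˢ (D ×ˢ D))).image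
      (fun q : (L × L) × (L × L) => (q.1.1 ⊔ q.2.1, q.1.2 ⊓ q.2.2))).subset
    rintro ⟨x, y⟩ ⟨_, a, b, c, d, h1, h2, h3, h4⟩
    refine ⟨((a, b), (c, d)), ?_, ?_⟩
    · simp only [Finset.coe_product, Set.mem_prod, Finset.mem_coe]
      exact ⟨⟨h1.1, h1.2.1⟩, h2.1, h2.2.1⟩
    · simp only at h3 h4
      simp [h3, h4]
  obtain ⟨M, -, hM, eM, hP⟩ := build hfin.toFinset
    (by
      intro s hs
      exact ((Set.Finite.mem_toFinset hfin).1 hs).1)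
    (by
      intro s hs t ht
      obtain ⟨l1, a, b, c, d, p1, p2, e1, e2⟩ := (Set.Finite.mem_toFinset hfin).1 hs
      obtain ⟨l2, a', b', c', d', q1, q2, f1, f2⟩ := (Set.Finite.mem_toFinset hfin).1 ht
      have k1 : a ≤ s.1 := e1 ▸ le_sup_left
      have k2 : c ≤ s.1 := e1 ▸ le_sup_right
      have k3 : s.2 ≤ b := e2 ▸ inf_le_left
      have k4 : s.2 ≤ d := e2 ▸ inf_le_right
      have k5 : a' ≤ t.1 := f1 ▸ le_sup_left
      have k6 : c' ≤ t.1 := f1 ▸ le_sup_right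
      have k7 : t.2 ≤ b' := f2 ▸ inf_le_left
      have k8 : t.2 ≤ d' := f2 ▸ inf_le_right
      rcases P_disj hC p1 q1 with h | h | h
      · rcases P_disj hD p2 q2 with h' | h' | h'
        · left
          ext
          · rw [e1, f1, h.1, h'.1]
          · rw [e2, f2, h.2, h'.2]
        · exact Or.inr (Or.inl (k4.trans_lt (h'.trans_le k6)))
        · exact Or.inr (Or.inr (k8.trans_lt (h'.trans_le k2)))
      · exact Or.inr (Or.inl (k3.trans_lt (h.trans_le k5)))
      · exact Or.inr (Or.inr (k7.trans_lt (h.trans_le k1))))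
  have hP' : ∀ x y, P M x y ↔ x < y ∧ ∃ a b c d, P C a b ∧ P D c d ∧ x = a ⊔ c ∧ y = b ⊓ d := by
    intro x y
    rw [hP, Set.Finite.mem_toFinset]
    rfl
  refine ⟨M, (mem_K _).2 ⟨hM, eM⟩, ?_, ?_, ?_⟩
  · intro x y h
    obtain ⟨_, a, b, c, d, p1, p2, rfl, rfl⟩ := (hP' x y).1 h
    exact ⟨a, b, p1, le_sup_left, inf_le_left⟩
  · intro x y h
    obtain ⟨_, a, b, c, d, p1, p2, rfl, rfl⟩ := (hP' x y).1 h
    exact ⟨c, d, p2, le_sup_right, inf_le_right⟩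
  · intro W _ h1 h2 x y h
    obtain ⟨a, b, p1, u1, v1⟩ := h1 x y h
    obtain ⟨c, d, p2, u2, v2⟩ := h2 x y h
    have i1 := sup_le u1 u2
    have i2 := le_inf v1 v2
    exact ⟨a ⊔ c, b ⊓ d, (hP' _ _).2 ⟨i1.trans_lt ((P_lt h).trans_le i2), a, b, c, d, p1, p2,
      rfl, rfl⟩, i1, i2⟩

theorem K_antisymm {C D : Finset L} (hC : Ch C) (eC : Even C.card) (hD : Ch D)
    (eD : Even D.card) (h1 : KalLER (· ≤ ·) C D) (h2 : KalLER (· ≤ ·) D C) : C = D := by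
  have key : ∀ {C D : Finset L}, Ch C → KalLER (· ≤ ·) C D → KalLER (· ≤ ·) D C →
      ∀ a b, P C a b → P D a b := by
    intro C D hC h1 h2 a b h
    obtain ⟨c, d, p, u, v⟩ := h1 a b h
    obtain ⟨a', b', p', u', v'⟩ := h2 c d p
    obtain ⟨rfl, rfl⟩ := P_eq hC h p' (P_lt h) le_rfl le_rfl (u'.trans u) (v.trans v')
    rw [le_antisymm u' u, le_antisymm v v']
    exact p
  ext x
  rw [mem_iff hC eC, mem_iff hD eD]
  constructor
  · rintro ⟨a, b, p, h⟩
    exact ⟨a, b, key hC h1 h2 a b p, h⟩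
  · rintro ⟨a, b, p, h⟩
    exact ⟨a, b, key hD h2 h1 a b p, h⟩

theorem K_trans {C D E : Finset L} (h1 : KalLER (· ≤ ·) C D) (h2 : KalLER (· ≤ ·) D E) :
    KalLER (· ≤ ·) C E := by
  intro a b h
  obtain ⟨c, d, p, u, v⟩ := h1 a b h
  obtain ⟨a', b', p', u', v'⟩ := h2 c d p
  exact ⟨a', b', p', u'.trans u, v.trans v'⟩

theorem K_refl (C : Finset L) : KalLER (· ≤ ·) C C :=
  fun a b h => ⟨a, b, h, le_rfl, le_rfl⟩

variable [BoundedOrder L] [Nontrivial L]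

theorem mem_compl (C : Finset L) (x : L) :
    x ∈ kalComplF ⊥ ⊤ C ↔ (x ∈ C ∧ x ≠ ⊥ ∧ x ≠ ⊤) ∨ (x ∉ C ∧ (x = ⊥ ∨ x = ⊤)) := by
  unfold kalComplF
  rw [Finset.mem_symmDiff]
  simp only [Finset.mem_insert, Finset.mem_singleton]
  tauto

theorem compl_Ch {C : Finset L} (hC : Ch C) : Ch (kalComplF ⊥ ⊤ C) := by
  intro a ha b hb
  rw [mem_compl] at ha hb
  rcases ha with ⟨ha, _⟩ | ⟨_, rfl | rfl⟩
  · rcases hb with ⟨hb, _⟩ | ⟨_, rfl | rfl⟩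
    · exact hC a ha b hb
    · simp
    · simp
  · simp
  · simp

theorem compl_even {C : Finset L} (eC : Even C.card) : Even (kalComplF ⊥ ⊤ C).card := by
  unfold kalComplF
  rw [even_card_symmDiff, Finset.card_pair bot_ne_top]
  simp [eC]

theorem compl_N {C : Finset L} {x : L} (hx : x ≠ ⊤) :
    Odd (N (kalComplF ⊥ ⊤ C) x) ↔ Even (N C x) := by
  unfold N
  have : (kalComplF ⊥ ⊤ C).filter (fun y => y ≤ x) =
      symmDiff (C.filter fun y => y ≤ x) {⊥} := by
    ext y
    rw [Finset.mem_filter, mem_compl, Finset.mem_symmDiff, Finset.mem_filter,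
      Finset.mem_singleton]
    by_cases h1 : y = ⊥
    · subst h1; simp
    · by_cases h2 : y = ⊤
      · subst h2; simp [hx]
      · simp [h1, h2]
  rw [this, ← Nat.not_even_iff_odd, even_card_symmDiff]
  simp

theorem compl_compl' (C : Finset L) : kalComplF ⊥ ⊤ (kalComplF ⊥ ⊤ C) = C := by
  unfold kalComplF
  simp

/-- orthogonality -/
theorem orth_pair {C : Finset L} (hC : Ch C) (eC : Even C.card) {c d : L} (hcd : c < d) :
    (∃ p q, P (kalComplF ⊥ ⊤ C) p q ∧ p ≤ c ∧ d ≤ q) ↔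
      ∀ a b, P C a b → b ≤ c ∨ d ≤ a := by
  constructor
  · rintro ⟨p, q, h, hpc, hdq⟩ a b hab
    suffices b ≤ p ∨ q ≤ a by
      rcases this with h | h
      · exact Or.inl (h.trans hpc)
      · exact Or.inr (hdq.trans h)
    rw [P_iff] at h hab
    obtain ⟨h1, h2, h3, h4, h5⟩ := h
    obtain ⟨k1, k2, k3, k4, k5⟩ := hab
    have hpt : p ≠ ⊤ := (h3.trans_le le_top).ne
    rw [compl_N hpt] at h4
    have hat : a ≠ ⊤ := (k3.trans_le le_top).ne
    have cmp : a ≤ p ∨ p ≤ a := by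
      rcases (mem_compl _ _).1 h1 with h | h
      · exact hC a k1 p h.1
      · rcases h.2 with rfl | rfl <;> simp
    have hne : a ≠ p := by
      rintro rfl
      exact (Nat.not_even_iff_odd.2 k4) h4
    rcases cmp with h | h
    · left
      have hlt := lt_of_le_of_ne h hne
      rcases (mem_compl _ _).1 h1 with h | h
      · exact k5 p h.1 hlt
      · rcases h.2 with rfl | rfl
        · exact absurd hlt not_lt_bot
        · exact le_top
    · right
      have hlt := lt_of_le_of_ne h (Ne.symm hne)
      exact h5 a ((mem_compl _ _).2 (Or.inl ⟨k1, (bot_le.trans_lt hlt).ne', hat⟩)) hlt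
  · intro H
    have H' : ∀ e ∈ C, e ≤ c ∨ d ≤ e := by
      intro e he
      obtain ⟨a, b, hab, rfl | rfl⟩ := (mem_iff hC eC e).1 he
      · exact (H _ _ hab).imp_left fun h => (P_lt hab).le.trans h
      · exact (H _ _ hab).imp_right fun h => h.trans (P_lt hab).le
    have ch1 : Ch (insert ⊥ (C.filter fun e => e ≤ c)) := by
      intro x hx y hy
      rw [Finset.mem_insert, Finset.mem_filter] at hx hy
      rcases hx with rfl | hx
      · simp
      · rcases hy with rfl | hy
        · simp
        · exact hC x hx.1 y hy.1
    have ch2 : Ch (insert ⊤ (C.filter fun e => d ≤ e)) := by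
      intro x hx y hy
      rw [Finset.mem_insert, Finset.mem_filter] at hx hy
      rcases hx with rfl | hx
      · simp
      · rcases hy with rfl | hy
        · simp
        · exact hC x hx.1 y hy.1
    obtain ⟨p, hp, hpm⟩ := greatest _ (Finset.insert_nonempty _ _) ch1
    obtain ⟨q, hq, hqm⟩ := least _ (Finset.insert_nonempty _ _) ch2
    have hpm' : ∀ x ∈ C, x ≤ c → x ≤ p := fun x hx h =>
      hpm x (Finset.mem_insert_of_mem (Finset.mem_filter.2 ⟨hx, h⟩))
    have hqm' : ∀ x ∈ C, d ≤ x → q ≤ x := fun x hx h =>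
      hqm x (Finset.mem_insert_of_mem (Finset.mem_filter.2 ⟨hx, h⟩))
    rw [Finset.mem_insert, Finset.mem_filter] at hp hq
    have hpc : p ≤ c := by
      rcases hp with rfl | hp
      · exact bot_le
      · exact hp.2
    have hdq : d ≤ q := by
      rcases hq with rfl | hq
      · exact le_top
      · exact hq.2
    have hpq : p < q := hpc.trans_lt (hcd.trans_le hdq)
    have hpt : p ≠ ⊤ := (hpq.trans_le le_top).ne
    have hqb : q ≠ ⊥ := (bot_le.trans_lt hpq).ne'
    have hpodd : p ∈ C → Even (N C p) := by
      intro hpC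
      by_contra ho
      rw [Nat.not_even_iff_odd] at ho
      obtain ⟨b, hb⟩ := exists_right hC eC hpC ho
      rcases H p b hb with h | h
      · exact absurd ((P_lt hb).trans_le (hpm' b hb.2.1 h)) (lt_irrefl _)
      · exact absurd (hcd.trans_le (h.trans hpc)) (lt_irrefl _)
    have hqev : q ∈ C → Odd (N C q) := by
      intro hqC
      by_contra ho
      rw [Nat.not_odd_iff_even] at ho
      obtain ⟨a, ha⟩ := exists_left hC hqC ho
      rcases H a q ha with h | h
      · exact absurd (hcd.trans_le (hdq.trans h)) (lt_irrefl _)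
      · exact absurd ((P_lt ha).trans_le (hqm' a ha.1 h)) (lt_irrefl _)
    have hbot : p = ⊥ → p ∉ C := by
      intro h hC'
      have e := hpodd hC'
      obtain ⟨a, ha⟩ := exists_left hC hC' e
      have := P_lt ha
      rw [h] at this
      exact not_lt_bot this
    have htop : q = ⊤ → q ∉ C := by
      intro h hC'
      have e := hqev hC'
      obtain ⟨a, ha⟩ := exists_right hC eC hC' e
      have := P_lt ha
      rw [h] at this
      exact not_top_lt this
    refine ⟨p, q, (P_iff _ _ _).2 ⟨?_, ?_, hpq, ?_, ?_⟩, hpc, hdq⟩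
    · rw [mem_compl]
      by_cases h : p = ⊥
      · exact Or.inr ⟨hbot h, Or.inl h⟩
      · exact Or.inl ⟨(hp.resolve_left h).1, h, hpt⟩
    · rw [mem_compl]
      by_cases h : q = ⊤
      · exact Or.inr ⟨htop h, Or.inr h⟩
      · exact Or.inl ⟨(hq.resolve_left h).1, hqb, h⟩
    · rw [compl_N hpt]
      by_cases h : p = ⊥
      · have : C.filter (fun y => y ≤ p) = ∅ := by
          rw [Finset.filter_eq_empty_iff]
          intro y hy hyp
          rw [h, le_bot_iff] at hyp
          exact hbot h (by rw [h, ← hyp]; exact hy)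
        unfold N
        rw [this]
        simp
      · exact hpodd (hp.resolve_left h).1
    · intro e he hpe
      rcases (mem_compl _ _).1 he with h | h
      · rcases H' e h.1 with h' | h'
        · exact absurd (hpe.trans_le (hpm' e h.1 h')) (lt_irrefl _)
        · exact hqm' e h.1 h'
      · rcases h.2 with rfl | rfl
        · exact absurd hpe not_lt_bot
        · exact le_top

theorem orth_iff {C D : Finset L} (hC : Ch C) (eC : Even C.card) :
    KalLER (· ≤ ·) D (kalComplF ⊥ ⊤ C) ↔
      ∀ a b c d, P C a b → P D c d → b ≤ c ∨ d ≤ a := by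
  rw [le_iff]
  constructor
  · intro h a b c d h1 h2
    exact (orth_pair hC eC (P_lt h2)).1 (h c d h2) a b h1
  · intro h c d h2
    exact (orth_pair hC eC (P_lt h2)).2 fun a b h1 => h a b c d h1 h2

theorem orth_symm {C D : Finset L} (hC : Ch C) (eC : Even C.card) (hD : Ch D)
    (eD : Even D.card) (h : KalLER (· ≤ ·) D (kalComplF ⊥ ⊤ C)) :
    KalLER (· ≤ ·) C (kalComplF ⊥ ⊤ D) := by
  rw [orth_iff hC eC] at h
  rw [orth_iff hD eD]
  exact fun a b c d h1 h2 => (h c d a b h2 h1).symm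

theorem compl_anti' {C D : Finset L} (hC : Ch C) (eC : Even C.card) (hD : Ch D)
    (eD : Even D.card) (h : KalLER (· ≤ ·) C D) :
    KalLER (· ≤ ·) (kalComplF ⊥ ⊤ D) (kalComplF ⊥ ⊤ C) := by
  apply orth_symm (compl_Ch hD) (compl_even eD) hC eC
  rw [compl_compl']
  exact h

theorem no_pair {C : Finset L} (hC : Ch C) (eC : Even C.card) (h : ∀ a b, ¬ P C a b) : C = ∅ := by
  rw [Finset.eq_empty_iff_forall_notMem]
  intro x hx
  obtain ⟨a, b, hab, _⟩ := (mem_iff hC eC x).1 hx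
  exact h a b hab

theorem P_empty (a b : L) : ¬ P (∅ : Finset L) a b := fun h => by simpa using h.1

theorem pair_K {c d : L} (h : c < d) :
    ∃ M : Finset L, M = {c, d} ∧ Ch M ∧ Even M.card ∧ ∀ a b, P M a b ↔ a = c ∧ b = d := by
  obtain ⟨M, h1, h2, h3, h4⟩ := build {(c, d)} (by simpa using h) (by simp)
  refine ⟨M, ?_, h2, h3, ?_⟩
  · ext x
    rw [h1]
    simp
  · intro a b
    rw [h4]
    simp

/-- the key to orthomodularity -/
theorem omod_key {C D : Finset L} (hC : Ch C) (eC : Even C.card) (hD : Ch D)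
    (h : KalLER (· ≤ ·) C D)
    (h0 : ∀ E : Finset L, Ch E → Even E.card → KalLER (· ≤ ·) E D →
      KalLER (· ≤ ·) E (kalComplF ⊥ ⊤ C) → E = ∅) : KalLER (· ≤ ·) D C := by
  have key : ∀ c d p q, P D c d → c ≤ p → p < q → q ≤ d →
      (∀ a b, P C a b → b ≤ p ∨ q ≤ a) → False := by
    intro c d p q hcd h1 h2 h3 h4
    obtain ⟨M, hM, g1, g2, g3⟩ := pair_K h2
    have : M = ∅ := by
      apply h0 M g1 g2
      · intro x y hxy
        obtain ⟨rfl, rfl⟩ := (g3 x y).1 hxy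
        exact ⟨c, d, hcd, h1, h3⟩
      · rw [orth_iff hC eC]
        intro a b x y hab hxy
        obtain ⟨rfl, rfl⟩ := (g3 x y).1 hxy
        exact h4 a b hab
    rw [hM] at this
    exact Finset.insert_ne_empty _ _ this
  -- least start above a point
  have gap : ∀ c d p, P D c d → c ≤ p → p ≤ d →
      (∀ a b, P C a b → b ≤ p ∨ p ≤ a) → p = d ∨ ∃ b, P C p b ∧ b ≤ d := by
    intro c d p hcd h1 h2 h3
    have ch : Ch (insert d (C.filter fun e => p ≤ e ∧ e ≤ d ∧ ∃ b, P C e b)) := by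
      intro x hx y hy
      rw [Finset.mem_insert, Finset.mem_filter] at hx hy
      rcases hx with rfl | hx
      · rcases hy with rfl | hy
        · simp
        · exact Or.inr hy.2.2.1
      · rcases hy with rfl | hy
        · exact Or.inl hx.2.2.1
        · exact hC x hx.1 y hy.1
    obtain ⟨q, hq, hqm⟩ := least _ (Finset.insert_nonempty _ _) ch
    have hqd : q ≤ d := hqm d (Finset.mem_insert_self _ _)
    have hpq : p ≤ q := by
      rw [Finset.mem_insert, Finset.mem_filter] at hq
      rcases hq with rfl | hq
      · exact h2
      · exact hq.2.1
    have hpq' : p = q := by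
      by_contra hne
      refine key c d p q hcd h1 (lt_of_le_of_ne hpq hne) hqd ?_
      intro a b hab
      rcases h3 a b hab with h' | h'
      · exact Or.inl h'
      · right
        obtain ⟨c', d', hcd', u, v⟩ := h a b hab
        rcases P_disj hD hcd hcd' with g | g | g
        · apply hqm
          exact Finset.mem_insert_of_mem (Finset.mem_filter.2
            ⟨hab.1, h', (P_lt hab).le.trans (v.trans g.2.ge), b, hab⟩)
        · exact hqd.trans (g.le.trans u)
        · exact absurd ((P_lt hab).trans_le (v.trans (g.le.trans (h1.trans h')))) (lt_irrefl _)
    rw [Finset.mem_insert, Finset.mem_filter] at hq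
    rcases hq with rfl | hq
    · exact Or.inl hpq'
    · right
      obtain ⟨_, _, hpd, b, hb⟩ := hq
      rw [← hpq'] at hb hpd
      refine ⟨b, hb, ?_⟩
      obtain ⟨c', d', hcd', u, v⟩ := h p b hb
      rcases P_disj hD hcd hcd' with g | g | g
      · exact v.trans g.2.ge
      · exact absurd (g.trans_le (u.trans h2)) (lt_irrefl _)
      · exact absurd ((P_lt hb).trans_le (v.trans (g.le.trans h1))) (lt_irrefl _)
  intro c d hcd
  have hlt : c < d := P_lt hcd
  rcases gap c d c hcd le_rfl hlt.le (by
    intro a b hab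
    obtain ⟨c', d', hcd', u, v⟩ := h a b hab
    rcases P_disj hD hcd hcd' with g | g | g
    · exact Or.inr (g.1.le.trans u)
    · exact Or.inr (hlt.le.trans (g.le.trans u))
    · exact Or.inl (v.trans g.le)) with g | ⟨b, hb, hbd⟩
  · exact absurd g hlt.ne
  · rcases gap c d b hcd (P_lt hb).le hbd (by
      intro a' b' hab'
      rcases P_disj hC hb hab' with g | g | g
      · exact Or.inl g.2.ge
      · exact Or.inr g.le
      · exact Or.inl (g.le.trans (P_lt hb).le)) with g | ⟨b', hb', _⟩
    · exact ⟨c, b, hb, le_rfl, g.ge⟩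
    · rcases P_disj hC hb hb' with g | g | g
      · exact absurd g.1 (P_lt hb).ne
      · exact absurd g (lt_irrefl _)
      · exact absurd ((P_lt hb).trans ((P_lt hb').trans g)) (lt_irrefl _)

theorem glb_to_lub {C D M : Finset L} (hC : Ch C) (eC : Even C.card) (hD : Ch D)
    (eD : Even D.card)
    (h : RelGLB (KalCarrier Set.univ ((· ≤ ·) : L → L → Prop)) (KalLER (· ≤ ·))
      (kalComplF ⊥ ⊤ C) (kalComplF ⊥ ⊤ D) M) :
    RelLUB (KalCarrier Set.univ ((· ≤ ·) : L → L → Prop)) (KalLER (· ≤ ·)) C D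
      (kalComplF ⊥ ⊤ M) := by
  obtain ⟨h1, h2, h3, h4⟩ := h
  obtain ⟨hM, eM⟩ := (mem_K _).1 h1
  refine ⟨(mem_K _).2 ⟨compl_Ch hM, compl_even eM⟩, orth_symm hC eC hM eM h2,
    orth_symm hD eD hM eM h3, ?_⟩
  intro W hW w1 w2
  obtain ⟨hW, eW⟩ := (mem_K _).1 hW
  have := compl_anti' (compl_Ch hW) (compl_even eW) hM eM
    (h4 _ ((mem_K _).2 ⟨compl_Ch hW, compl_even eW⟩) (compl_anti' hC eC hW eW w1)
      (compl_anti' hD eD hW eW w2))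
  rwa [compl_compl'] at this

theorem exists_join {C D : Finset L} (hC : Ch C) (eC : Even C.card) (hD : Ch D)
    (eD : Even D.card) :
    ∃ J, RelLUB (KalCarrier Set.univ ((· ≤ ·) : L → L → Prop)) (KalLER (· ≤ ·)) C D J := by
  obtain ⟨M, hM⟩ := exists_meet (compl_Ch hC) (compl_even eC) (compl_Ch hD) (compl_even eD)
  exact ⟨_, glb_to_lub hC eC hD eD hM⟩

theorem disjoint_compl {C W : Finset L} (hC : Ch C) (eC : Even C.card) (hW : Ch W)
    (eW : Even W.card) (h1 : KalLER (· ≤ ·) W C) (h2 : KalLER (· ≤ ·) W (kalComplF ⊥ ⊤ C)) :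
    W = ∅ := by
  apply no_pair hW eW
  intro a b hab
  obtain ⟨c, d, hcd, u, v⟩ := h1 a b hab
  rw [orth_iff hC eC] at h2
  rcases h2 c d a b hcd hab with h | h
  · exact absurd ((P_lt hab).trans_le (v.trans h)) (lt_irrefl _)
  · exact absurd ((P_lt hab).trans_le (h.trans u)) (lt_irrefl _)

theorem empty_K : Ch (∅ : Finset L) ∧ Even (∅ : Finset L).card :=
  ⟨fun a ha => by simp at ha, by simp⟩

theorem empty_le (C : Finset L) : KalLER (· ≤ ·) ∅ C :=
  fun a b h => absurd h (P_empty a b)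

theorem omod {C D : Finset L} (hC : Ch C) (eC : Even C.card) (hD : Ch D)
    (eD : Even D.card) (h : KalLER (· ≤ ·) C D) :
    ∃ j, RelLUB (KalCarrier Set.univ ((· ≤ ·) : L → L → Prop)) (KalLER (· ≤ ·)) C
        (kalComplF ⊥ ⊤ D) j ∧
      RelLUB (KalCarrier Set.univ ((· ≤ ·) : L → L → Prop)) (KalLER (· ≤ ·)) C
        (kalComplF ⊥ ⊤ j) D := by
  obtain ⟨M, hM⟩ := exists_meet (compl_Ch hC) (compl_even eC) hD eD
  refine ⟨kalComplF ⊥ ⊤ M, glb_to_lub hC eC (compl_Ch hD) (compl_even eD) ?_, ?_⟩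
  · rw [compl_compl']
    exact hM
  rw [compl_compl']
  obtain ⟨m1, m2, m3, m4⟩ := hM
  obtain ⟨cM, eM⟩ := (mem_K _).1 m1
  refine ⟨(mem_K _).2 ⟨hD, eD⟩, h, m3, ?_⟩
  obtain ⟨J, j1, j2, j3, j4⟩ := exists_join hC eC cM eM
  obtain ⟨cJ, eJ⟩ := (mem_K _).1 j1
  have hJD : KalLER (· ≤ ·) J D := j4 D ((mem_K _).2 ⟨hD, eD⟩) h m3
  have hDJ : KalLER (· ≤ ·) D J := by
    apply omod_key cJ eJ hD hJD
    intro E cE eE hED hEJ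
    have hEC := K_trans hEJ (compl_anti' hC eC cJ eJ j2)
    have hEM := K_trans hEJ (compl_anti' cM eM cJ eJ j3)
    have := m4 E ((mem_K _).2 ⟨cE, eE⟩) hEC hED
    exact disjoint_compl cM eM cE eE this hEM
  intro W hW w1 w2
  exact K_trans hDJ (j4 W hW w1 w2)

theorem empty_compl : kalComplF (⊥ : L) ⊤ ∅ = {⊥, ⊤} := by
  unfold kalComplF
  ext x
  simp [Finset.mem_symmDiff]

end KH

end KalHelpers

/-- If `L` is a bounded lattice then the Kalmbach extension `K(L)`
is a lattice (all binary meets and joins exist), and together with the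
orthocomplementation `C ↦ C Δ {0,1}` it is an orthomodular lattice; consequently
every bounded lattice embeds (via `η`) into an orthomodular lattice. -/
theorem kalmbach_extension_of_lattice_is_orthomodular_lattice
    (L : Type u) [Lattice L] [BoundedOrder L] [Nontrivial L] :
    (∀ C ∈ KalCarrier Set.univ ((· ≤ ·) : L → L → Prop),
       ∀ D ∈ KalCarrier Set.univ ((· ≤ ·) : L → L → Prop),
         (∃ M, RelGLB (KalCarrier Set.univ ((· ≤ ·) : L → L → Prop)) (KalLER (· ≤ ·)) C D M) ∧
         (∃ J, RelLUB (KalCarrier Set.univ ((· ≤ ·) : L → L → Prop)) (KalLER (· ≤ ·)) C D J)) ∧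
    IsOrthomodularPosetOn (KalCarrier Set.univ ((· ≤ ·) : L → L → Prop))
      (KalLER (· ≤ ·)) (kalComplF (⊥ : L) ⊤) (∅ : Finset L) ({⊥, ⊤} : Finset L) ∧
    (∀ a : L, kalEtaF ⊥ a ∈ KalCarrier Set.univ ((· ≤ ·) : L → L → Prop)) ∧
    (∀ a b : L, a ≤ b ↔ KalLER (· ≤ ·) (kalEtaF ⊥ a) (kalEtaF ⊥ b)) := by
  have hsplit : ∀ C : Finset L, C ∈ KalCarrier Set.univ ((· ≤ ·) : L → L → Prop) →
      KH.Ch C ∧ Even C.card := fun C h => (KH.mem_K C).1 h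
  refine ⟨?_, ?_, ?_, ?_⟩
  · intro C hC D hD
    obtain ⟨hC, eC⟩ := hsplit C hC
    obtain ⟨hD, eD⟩ := hsplit D hD
    exact ⟨KH.exists_meet hC eC hD eD, KH.exists_join hC eC hD eD⟩
  · have hE := KH.empty_K (L := L)
    exact
      { bot_mem := (KH.mem_K _).2 hE
        top_mem := by
          rw [← KH.empty_compl]
          exact (KH.mem_K _).2 ⟨KH.compl_Ch hE.1, KH.compl_even hE.2⟩
        compl_mem := fun x hx => (KH.mem_K _).2
          ⟨KH.compl_Ch (hsplit x hx).1, KH.compl_even (hsplit x hx).2⟩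
        refl := fun x _ => KH.K_refl x
        antisymm := fun x hx y hy => KH.K_antisymm (hsplit x hx).1 (hsplit x hx).2
          (hsplit y hy).1 (hsplit y hy).2
        trans := fun x _ y _ w _ => KH.K_trans
        bot_le := fun x _ => KH.empty_le x
        le_top := fun x _ => by
          rw [← KH.empty_compl, KH.orth_iff hE.1 hE.2]
          exact fun a b _ _ h => absurd h (KH.P_empty a b)
        compl_anti := fun x hx y hy => KH.compl_anti' (hsplit x hx).1 (hsplit x hx).2
          (hsplit y hy).1 (hsplit y hy).2
        compl_compl := fun x _ => KH.compl_compl' x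
        inf_compl := fun x hx => ⟨(KH.mem_K _).2 hE, KH.empty_le _, KH.empty_le _,
          fun w hw h1 h2 => by
            rw [KH.disjoint_compl (hsplit x hx).1 (hsplit x hx).2 (hsplit w hw).1
              (hsplit w hw).2 h1 h2]
            exact KH.K_refl _⟩
        sup_of_orth := fun x hx y hy _ => KH.exists_join (hsplit x hx).1 (hsplit x hx).2
          (hsplit y hy).1 (hsplit y hy).2
        orthomodular := fun x hx y hy => KH.omod (hsplit x hx).1 (hsplit x hx).2
          (hsplit y hy).1 (hsplit y hy).2 }
  · intro a
    unfold kalEtaF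
    split_ifs with h
    · exact (KH.mem_K _).2 KH.empty_K
    · obtain ⟨M, hM, h1, h2, _⟩ := KH.pair_K (bot_lt_iff_ne_bot.2 h)
      rw [← hM]
      exact (KH.mem_K _).2 ⟨h1, h2⟩
  · intro a b
    unfold kalEtaF
    by_cases ha : a = ⊥
    · subst ha
      simp only [if_true, bot_le, true_iff]
      exact KH.empty_le _
    · rw [if_neg ha]
      obtain ⟨M, hM, _, _, hP⟩ := KH.pair_K (bot_lt_iff_ne_bot.2 ha)
      rw [← hM]
      have hPa : KH.P M ⊥ a := (hP _ _).2 ⟨rfl, rfl⟩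
      by_cases hb : b = ⊥
      · subst hb
        rw [if_pos rfl]
        constructor
        · intro h
          exact absurd (le_bot_iff.1 h) ha
        · intro h
          obtain ⟨c, d, hcd, _⟩ := h _ _ hPa
          exact absurd hcd (KH.P_empty c d)
      · rw [if_neg hb]
        obtain ⟨M', hM', _, _, hP'⟩ := KH.pair_K (bot_lt_iff_ne_bot.2 hb)
        rw [← hM']
        constructor
        · intro h x y hxy
          obtain ⟨rfl, rfl⟩ := (hP _ _).1 hxy
          exact ⟨⊥, b, (hP' _ _).2 ⟨rfl, rfl⟩, le_rfl, h⟩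
        · intro h
          obtain ⟨c, d, hcd, _, h'⟩ := h _ _ hPa
          obtain ⟨rfl, rfl⟩ := (hP' _ _).1 hcd
          exact h'
end

section
/- For every morphism of bounded posets f : P → Q, the map K(f) : K(P) → K(Q) defined by K(f)([x₁<x₂<…<x_{2n}]) = {f(x₁)} Δ {f(x₂)} Δ … Δ {f(x_{2n})} (symmetric difference of singletons, i.e. the set of y in Q such that the number of indices i with f(x_i)=y is odd) is a morphism of orthomodular posets, and this assignment is functorial: K(id_P) = id_{K(P)} and K(g∘f) = K(g)∘K(f). -/
attribute [local instance] Classical.propDecidable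

universe u v w

/-- A morphism of orthomodular posets (presented on carrier sets): it preserves the
top element and, whenever `a ≤ b'`, it satisfies `φ a ≤ (φ b)'` and
`φ (a ∨ b) = φ a ∨ φ b`. -/
structure RelOMPHom {α : Type u} {β : Type v} (S₁ : Set α) (r₁ : α → α → Prop)
    (oc₁ : α → α) (t₁ : α) (S₂ : Set β) (r₂ : β → β → Prop) (oc₂ : β → β) (t₂ : β)
    (φ : α → β) : Prop where
  mem : ∀ x ∈ S₁, φ x ∈ S₂
  map_top : φ t₁ = t₂
  map_orth : ∀ a ∈ S₁, ∀ b ∈ S₁, r₁ a (oc₁ b) → r₂ (φ a) (oc₂ (φ b))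
  map_sup : ∀ a ∈ S₁, ∀ b ∈ S₁, r₁ a (oc₁ b) → ∀ j, RelLUB S₁ r₁ a b j →
      RelLUB S₂ r₂ (φ a) (φ b) (φ j)

section Helpers

/-- parity indicator -/
def KN {α : Type u} [PartialOrder α] (C : Finset α) (x : α) : Prop :=
  Odd (C.filter fun y => y ≤ x).card

def KCh {α : Type u} [PartialOrder α] (C : Finset α) : Prop :=
  ∀ a ∈ C, ∀ b ∈ C, a ≤ b ∨ b ≤ a

lemma kch_max {α : Type u} [PartialOrder α] {C : Finset α} (h : KCh C) (hne : C.Nonempty) :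
    ∃ m ∈ C, ∀ c ∈ C, c ≤ m := by
  obtain ⟨m, hm⟩ := C.exists_maximal hne
  refine ⟨m, hm.1, fun c hc => ?_⟩
  rcases h c hc m hm.1 with h1 | h1
  · exact h1
  · exact hm.2 hc h1

lemma kch_min {α : Type u} [PartialOrder α] {C : Finset α} (h : KCh C) (hne : C.Nonempty) :
    ∃ m ∈ C, ∀ c ∈ C, m ≤ c := by
  obtain ⟨m, hm⟩ := C.exists_minimal hne
  refine ⟨m, hm.1, fun c hc => ?_⟩
  rcases h m hm.1 c hc with h1 | h1
  · exact h1
  · exact hm.2 hc h1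

lemma kch_sub {α : Type u} [PartialOrder α] {C D : Finset α} (h : KCh C) (hs : D ⊆ C) : KCh D :=
  fun a ha b hb => h a (hs ha) b (hs hb)

lemma odd_card_nonempty {α : Type u} {C : Finset α} (h : Odd C.card) : C.Nonempty := by
  rw [← Finset.card_pos]; exact h.pos

lemma pair_exists {α : Type u} [PartialOrder α] {C : Finset α} (h : KCh C) (he : Even C.card)
    (x : α) (hx : KN C x) :
    ∃ a b, KalPairR (· ≤ ·) C a b ∧ a ≤ x ∧ ¬ b ≤ x := by
  obtain ⟨a, ha, hmax⟩ := kch_max (kch_sub h (Finset.filter_subset _ _)) (odd_card_nonempty hx)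
  rw [Finset.mem_filter] at ha
  have hG : (C.filter fun y => ¬ y ≤ x).Nonempty := by
    rw [Finset.nonempty_iff_ne_empty]
    intro h0
    rw [Finset.filter_eq_empty_iff] at h0
    have : C.filter (fun y => y ≤ x) = C := by
      rw [Finset.filter_eq_self]
      intro c hc
      exact not_not.1 (h0 hc)
    unfold KN at hx
    rw [this] at hx
    exact (Nat.not_even_iff_odd.2 hx) he
  obtain ⟨b, hb, hmin⟩ := kch_min (kch_sub h (Finset.filter_subset _ _)) hG
  rw [Finset.mem_filter] at hb
  have hF : C.filter (fun y => y ≤ a) = C.filter (fun y => y ≤ x) := by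
    apply Finset.filter_congr
    intro c hc
    exact ⟨fun h1 => h1.trans ha.2, fun h1 => hmax c (Finset.mem_filter.2 ⟨hc, h1⟩)⟩
  refine ⟨a, b, ⟨ha.1, hb.1, ?_, ?_, ?_, ?_⟩, ha.2, hb.2⟩
  · rcases h a ha.1 b hb.1 with h1 | h1
    · exact h1
    · exact absurd (h1.trans ha.2) hb.2
  · rintro rfl
    exact hb.2 ha.2
  · show Odd (C.filter (fun y => y ≤ a)).card
    rw [hF]; exact hx
  · intro c hc hac hne
    apply hmin
    rw [Finset.mem_filter]
    refine ⟨hc, fun hcx => hne ?_⟩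
    exact le_antisymm (hmax c (Finset.mem_filter.2 ⟨hc, hcx⟩)) hac

lemma pair_odd {α : Type u} [PartialOrder α] {C : Finset α} (h : KCh C) {a b x : α}
    (hp : KalPairR (· ≤ ·) C a b) (hax : a ≤ x) (hbx : ¬ b ≤ x) : KN C x := by
  obtain ⟨ha, hb, hab, hne, hodd, hs⟩ := hp
  have hF : C.filter (fun y => y ≤ x) = C.filter (fun y => y ≤ a) := by
    apply Finset.filter_congr
    intro c hc
    refine ⟨fun h1 => ?_, fun h1 => h1.trans hax⟩
    by_contra h2
    have h3 : a ≤ c := (h a ha c hc).resolve_right h2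
    exact hbx ((hs c hc h3 (fun e => h2 (e ▸ le_rfl))).trans h1)
  unfold KN
  rw [hF]; exact hodd

lemma pair_right {α : Type u} [PartialOrder α] {C : Finset α} (h : KCh C) {a b : α}
    (hp : KalPairR (· ≤ ·) C a b) : ¬ KN C b := by
  obtain ⟨ha, hb, hab, hne, hodd, hs⟩ := hp
  have hba : ¬ b ≤ a := fun h1 => hne (le_antisymm hab h1)
  have hF : C.filter (fun y => y ≤ b) = insert b (C.filter (fun y => y ≤ a)) := by
    ext c
    simp only [Finset.mem_filter, Finset.mem_insert]
    constructor
    · rintro ⟨hc, h1⟩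
      by_cases h2 : c ≤ a
      · exact Or.inr ⟨hc, h2⟩
      · have h3 : a ≤ c := (h a ha c hc).resolve_right h2
        exact Or.inl (le_antisymm h1 (hs c hc h3 (fun e => h2 (e ▸ le_rfl))))
    · rintro (rfl | ⟨hc, h1⟩)
      · exact ⟨hb, le_rfl⟩
      · exact ⟨hc, h1.trans hab⟩
  unfold KN
  rw [hF, Finset.card_insert_of_notMem (by simp [hba])]
  have hodd' : Odd (C.filter (fun y => y ≤ a)).card := hodd
  rw [Nat.not_odd_iff_even]
  exact hodd'.add_one

lemma pair_cover {α : Type u} [PartialOrder α] {C : Finset α} (h : KCh C) (he : Even C.card)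
    {c : α} (hc : c ∈ C) : ∃ a b, KalPairR (· ≤ ·) C a b ∧ a ≤ c ∧ c ≤ b := by
  by_cases hN : KN C c
  · obtain ⟨a, b, hp, h1, h2⟩ := pair_exists h he c hN
    exact ⟨a, b, hp, h1, (h c hc b hp.2.1).resolve_right h2⟩
  · have hF : C.filter (fun y => y ≤ c) = insert c (C.filter (fun y => y < c)) := by
      ext d
      simp only [Finset.mem_filter, Finset.mem_insert, le_iff_eq_or_lt]
      constructor
      · rintro ⟨h1, h2 | h2⟩
        · exact Or.inl h2
        · exact Or.inr ⟨h1, h2⟩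
      · rintro (rfl | ⟨h1, h2⟩)
        · exact ⟨hc, Or.inl rfl⟩
        · exact ⟨h1, Or.inr h2⟩
    have hodd : Odd (C.filter (fun y => y < c)).card := by
      unfold KN at hN
      rw [hF, Finset.card_insert_of_notMem (by simp)] at hN
      by_contra h1
      exact hN (Nat.not_odd_iff_even.1 h1).add_one
    obtain ⟨x, hx, hmax⟩ := kch_max (kch_sub h (Finset.filter_subset _ _)) (odd_card_nonempty hodd)
    rw [Finset.mem_filter] at hx
    have hF2 : C.filter (fun y => y ≤ x) = C.filter (fun y => y < c) := by
      apply Finset.filter_congr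
      intro d hd
      exact ⟨fun h1 => h1.trans_lt hx.2, fun h1 => hmax d (Finset.mem_filter.2 ⟨hd, h1⟩)⟩
    have hxN : KN C x := by
      unfold KN
      rw [hF2]; exact hodd
    obtain ⟨a, b, hp, h1, h2⟩ := pair_exists h he x hxN
    refine ⟨a, b, hp, h1.trans hx.2.le, ?_⟩
    rcases h c hc b hp.2.1 with h3 | h3
    · exact h3
    · rcases h3.eq_or_lt with h4 | h4
      · exact h4.ge
      · exact absurd (hmax b (Finset.mem_filter.2 ⟨hp.2.1, h4⟩)) h2

lemma kch_union {α : Type u} [PartialOrder α] {C D : Finset α} (hC : KCh C) (hD : KCh D)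
    (h : ∀ a ∈ C, ∀ b ∈ D, a ≤ b ∨ b ≤ a) : KCh (C ∪ D) := by
  intro a ha b hb
  rw [Finset.mem_union] at ha hb
  rcases ha with ha | ha <;> rcases hb with hb | hb
  · exact hC a ha b hb
  · exact h a ha b hb
  · exact (h b hb a ha).symm
  · exact hD a ha b hb

lemma kal_le_iff {α : Type u} [PartialOrder α] {C D : Finset α}
    (hC : KCh C) (heC : Even C.card) (hD : KCh D) (heD : Even D.card) :
    KalLER (· ≤ ·) C D ↔ KCh (C ∪ D) ∧ ∀ x, KN C x → KN D x := by
  constructor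
  · intro h
    constructor
    · apply kch_union hC hD
      intro c hc d hd
      obtain ⟨a, b, hp, h1, h2⟩ := pair_cover hC heC hc
      obtain ⟨a', b', hp', h1', h2'⟩ := h a b hp
      by_cases hda : d ≤ a'
      · exact Or.inr (hda.trans (h1'.trans h1))
      · have h3 : a' ≤ d := (hD d hd a' hp'.1).resolve_left hda
        have h4 : b' ≤ d := hp'.2.2.2.2.2 d hd h3 (fun e => hda (e ▸ le_rfl))
        exact Or.inl (h2.trans (h2'.trans h4))
    · intro x hx
      obtain ⟨a, b, hp, h1, h2⟩ := pair_exists hC heC x hx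
      obtain ⟨a', b', hp', h1', h2'⟩ := h a b hp
      exact pair_odd hD hp' (h1'.trans h1) (fun h3 => h2 (h2'.trans h3))
  · rintro ⟨hU, hN⟩ a b hp
    have ha : KN D a := hN a hp.2.2.2.2.1
    obtain ⟨c, d, hp', h1, h2⟩ := pair_exists hD heD a ha
    refine ⟨c, d, hp', h1, ?_⟩
    by_contra h3
    have had : a ≤ d := (hU a (Finset.mem_union_left _ hp.1) d
      (Finset.mem_union_right _ hp'.2.1)).resolve_right h2
    exact pair_right hD hp' (hN d (pair_odd hC hp had h3))

lemma odd_symmDiff {α : Type u} (A B : Finset α) (p : α → Prop) :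
    Odd ((symmDiff A B).filter p).card ↔
      ¬ (Odd (A.filter p).card ↔ Odd (B.filter p).card) := by
  have e : (symmDiff A B).filter p = symmDiff (A.filter p) (B.filter p) := by
    ext x
    simp only [Finset.mem_filter, Finset.mem_symmDiff]
    tauto
  rw [e]
  generalize A.filter p = A
  generalize B.filter p = B
  have h1 : (symmDiff A B).card = (A \ B).card + (B \ A).card := by
    rw [← Finset.card_union_of_disjoint disjoint_sdiff_sdiff]
    rfl
  have h2 := Finset.card_sdiff_add_card_inter A B
  have h3 := Finset.card_sdiff_add_card_inter B A
  rw [Finset.inter_comm B A] at h3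
  simp only [Nat.odd_iff]
  omega

lemma KN_symmDiff {α : Type u} [PartialOrder α] (A B : Finset α) (x : α) :
    KN (symmDiff A B) x ↔ ¬ (KN A x ↔ KN B x) := odd_symmDiff A B _

lemma even_symmDiff {α : Type u} {A B : Finset α} (hA : Even A.card) (hB : Even B.card) :
    Even (symmDiff A B).card := by
  have := odd_symmDiff A B (fun _ => True)
  simp only [Finset.filter_true] at this
  rw [← Nat.not_odd_iff_even] at *
  tauto

lemma KN_ext {α : Type u} [PartialOrder α] {A B : Finset α} (h : ∀ x, KN A x ↔ KN B x) :
    A = B := by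
  by_contra hne
  have hE : (symmDiff A B).Nonempty := by
    rw [Finset.nonempty_iff_ne_empty]
    intro h0
    exact hne (symmDiff_eq_bot.1 h0)
  obtain ⟨m, hm⟩ := (symmDiff A B).exists_minimal hE
  have h1 : (symmDiff A B).filter (fun y => y ≤ m) = {m} := by
    ext c
    simp only [Finset.mem_filter, Finset.mem_singleton]
    constructor
    · rintro ⟨hc, h1⟩
      exact le_antisymm h1 (hm.2 hc h1)
    · rintro rfl
      exact ⟨hm.1, le_rfl⟩
  have h2 : KN (symmDiff A B) m := by
    unfold KN
    rw [h1]; simp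
  exact (KN_symmDiff A B m).1 h2 (h m)

lemma KN_top {α : Type u} [PartialOrder α] [BoundedOrder α] {A : Finset α} (h : Even A.card) :
    ¬ KN A ⊤ := by
  unfold KN
  simpa using h

lemma KN_bt {α : Type u} [PartialOrder α] [BoundedOrder α] {x : α} (h : x ≠ ⊤) :
    KN ({⊥, ⊤} : Finset α) x := by
  have : ({⊥, ⊤} : Finset α).filter (fun y => y ≤ x) = {⊥} := by
    ext c
    simp only [Finset.mem_filter, Finset.mem_insert, Finset.mem_singleton]
    constructor
    · rintro ⟨rfl | rfl, h1⟩
      · rfl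
      · exact absurd (top_le_iff.1 h1) h
    · rintro rfl
      exact ⟨Or.inl rfl, bot_le⟩
  unfold KN
  rw [this]; simp

lemma even_bt {α : Type u} [PartialOrder α] [BoundedOrder α] [Nontrivial α] :
    Even ({⊥, ⊤} : Finset α).card := by
  rw [Finset.card_pair bot_ne_top]
  exact even_two

lemma kch_bt {α : Type u} [PartialOrder α] [BoundedOrder α] {C : Finset α} (h : KCh C) :
    KCh (C ∪ {⊥, ⊤}) := by
  apply kch_union h
  · intro a ha b hb
    simp only [Finset.mem_insert, Finset.mem_singleton] at ha hb
    rcases ha with rfl | rfl <;> simp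
  · intro a ha b hb
    simp only [Finset.mem_insert, Finset.mem_singleton] at ha hb
    rcases hb with rfl | rfl <;> simp

lemma symmDiff_sub {α : Type u} (A B : Finset α) : symmDiff A B ⊆ A ∪ B := by
  intro x hx
  rw [Finset.mem_symmDiff] at hx
  rw [Finset.mem_union]
  tauto

lemma kch_compl {α : Type u} [PartialOrder α] [BoundedOrder α] {C : Finset α} (h : KCh C) :
    KCh (kalComplF ⊥ ⊤ C) :=
  kch_sub (kch_bt h) (symmDiff_sub _ _)

lemma even_compl {α : Type u} [PartialOrder α] [BoundedOrder α] [Nontrivial α] {C : Finset α}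
    (h : Even C.card) : Even (kalComplF ⊥ ⊤ C).card :=
  even_symmDiff h even_bt

lemma kal_orth {α : Type u} [PartialOrder α] [BoundedOrder α] [Nontrivial α] {A B : Finset α}
    (hA : KCh A) (heA : Even A.card) (hB : KCh B) (heB : Even B.card)
    (h : KalLER (· ≤ ·) A (kalComplF ⊥ ⊤ B)) :
    KCh (A ∪ B) ∧ ∀ x, KN A x → ¬ KN B x := by
  rw [kal_le_iff hA heA (kch_compl hB) (even_compl heB)] at h
  obtain ⟨hU, hN⟩ := h
  constructor
  · refine kch_sub (kch_bt hU) ?_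
    intro x hx
    simp only [kalComplF, Finset.mem_union, Finset.mem_symmDiff] at hx ⊢
    tauto
  · intro x hx
    have hxt : x ≠ ⊤ := by
      rintro rfl
      exact KN_top heA hx
    have h1 := (KN_symmDiff B {⊥, ⊤} x).1 (hN x hx)
    have h2 := KN_bt hxt
    tauto

lemma kal_mem {α : Type u} [PartialOrder α] {C : Finset α} :
    C ∈ KalCarrier Set.univ ((· ≤ ·) : α → α → Prop) ↔ KCh C ∧ Even C.card := by
  simp [KalCarrier, IsEvenChainR, KCh]

lemma kal_sup {α : Type u} [PartialOrder α] [BoundedOrder α] [Nontrivial α] {A B : Finset α}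
    (hA : KCh A) (heA : Even A.card) (hB : KCh B) (heB : Even B.card)
    (h : KalLER (· ≤ ·) A (kalComplF ⊥ ⊤ B)) :
    RelLUB (KalCarrier Set.univ ((· ≤ ·) : α → α → Prop)) (KalLER (· ≤ ·)) A B
      (symmDiff A B) := by
  obtain ⟨hU, hN⟩ := kal_orth hA heA hB heB h
  have hS : KCh (symmDiff A B) := kch_sub hU (symmDiff_sub _ _)
  have heS : Even (symmDiff A B).card := even_symmDiff heA heB
  refine ⟨kal_mem.2 ⟨hS, heS⟩, ?_, ?_, ?_⟩
  · rw [kal_le_iff hA heA hS heS]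
    refine ⟨kch_sub hU (Finset.union_subset Finset.subset_union_left (symmDiff_sub _ _)), ?_⟩
    intro x hx
    have := hN x hx
    rw [KN_symmDiff]
    tauto
  · rw [kal_le_iff hB heB hS heS]
    refine ⟨kch_sub hU (Finset.union_subset Finset.subset_union_right (symmDiff_sub _ _)), ?_⟩
    intro x hx
    have := hN x
    rw [KN_symmDiff]
    tauto
  · intro W hW hAW hBW
    rw [kal_mem] at hW
    rw [kal_le_iff hA heA hW.1 hW.2] at hAW
    rw [kal_le_iff hB heB hW.1 hW.2] at hBW
    rw [kal_le_iff hS heS hW.1 hW.2]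
    constructor
    · apply kch_union hS hW.1
      intro a ha b hb
      rcases Finset.mem_union.1 (symmDiff_sub _ _ ha) with h1 | h1
      · exact hAW.1 a (Finset.mem_union_left _ h1) b (Finset.mem_union_right _ hb)
      · exact hBW.1 a (Finset.mem_union_left _ h1) b (Finset.mem_union_right _ hb)
    · intro x hx
      rw [KN_symmDiff] at hx
      have := hAW.2 x
      have := hBW.2 x
      tauto

lemma mem_kalMap {α : Type u} {β : Type v} (f : α → β) (C : Finset α) (y : β) :
    y ∈ kalMapF f C ↔ Odd (C.filter fun x => f x = y).card := by
  unfold kalMapF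
  rw [Finset.mem_filter]
  refine ⟨fun h => h.2, fun h => ⟨?_, h⟩⟩
  obtain ⟨x, hx⟩ := odd_card_nonempty h
  rw [Finset.mem_filter] at hx
  exact Finset.mem_image.2 ⟨x, hx.1, hx.2⟩

lemma kalMap_parity {α : Type u} {β : Type v} (f : α → β) (C : Finset α) (p : β → Prop) :
    Odd ((kalMapF f C).filter p).card ↔ Odd (C.filter fun x => p (f x)).card := by
  have h1 : (C.filter fun x => p (f x)).card =
      ∑ y ∈ C.image f, ((C.filter fun x => p (f x)).filter fun x => f x = y).card := by
    apply Finset.card_eq_sum_card_fiberwise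
    intro x hx
    have hx' := Finset.mem_coe.1 hx
    exact Finset.mem_coe.2 (Finset.mem_image_of_mem f (Finset.mem_filter.1 hx').1)
  rw [h1, Finset.odd_sum_iff_odd_card_odd]
  have : (kalMapF f C).filter p = (C.image f).filter (fun y =>
      Odd ((C.filter fun x => p (f x)).filter fun x => f x = y).card) := by
    unfold kalMapF
    rw [Finset.filter_filter]
    apply Finset.filter_congr
    intro y hy
    rw [Finset.filter_filter]
    by_cases hp : p y
    · have : C.filter (fun x => p (f x) ∧ f x = y) = C.filter (fun x => f x = y) := by
        apply Finset.filter_congr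
        intro x _
        exact ⟨fun h => h.2, fun h => ⟨h ▸ hp, h⟩⟩
      rw [this]
      exact ⟨fun h => h.1, fun h => ⟨h, hp⟩⟩
    · have : C.filter (fun x => p (f x) ∧ f x = y) = ∅ := by
        rw [Finset.filter_eq_empty_iff]
        rintro x _ ⟨h, rfl⟩
        exact hp h
      rw [this]
      simp [hp]
  rw [this]

lemma kalMap_symmDiff {α : Type u} {β : Type v} (f : α → β) (A B : Finset α) :
    kalMapF f (symmDiff A B) = symmDiff (kalMapF f A) (kalMapF f B) := by
  ext y
  rw [Finset.mem_symmDiff, mem_kalMap, mem_kalMap, mem_kalMap, odd_symmDiff]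
  tauto

lemma kalMap_even {α : Type u} {β : Type v} (f : α → β) {C : Finset α} (h : Even C.card) :
    Even (kalMapF f C).card := by
  have := kalMap_parity f C (fun _ => True)
  simp only [Finset.filter_true] at this
  rw [← Nat.not_odd_iff_even] at *
  tauto

lemma kch_image {α : Type u} {β : Type v} [PartialOrder α] [PartialOrder β] {f : α → β}
    (hf : Monotone f) {C : Finset α} (h : KCh C) : KCh (C.image f) := by
  intro a ha b hb
  obtain ⟨x, hx, rfl⟩ := Finset.mem_image.1 ha
  obtain ⟨y, hy, rfl⟩ := Finset.mem_image.1 hb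
  exact (h x hx y hy).imp (fun h => hf h) (fun h => hf h)

lemma kalMap_sub {α : Type u} {β : Type v} (f : α → β) (C : Finset α) :
    kalMapF f C ⊆ C.image f := Finset.filter_subset _ _

lemma kch_map {α : Type u} {β : Type v} [PartialOrder α] [PartialOrder β] {f : α → β}
    (hf : Monotone f) {C : Finset α} (h : KCh C) : KCh (kalMapF f C) :=
  kch_sub (kch_image hf h) (kalMap_sub f C)

lemma kalMap_mono {α : Type u} {β : Type v} [PartialOrder α] [PartialOrder β] {f : α → β}
    (hf : Monotone f) {C D : Finset α}
    (hC : KCh C) (heC : Even C.card) (hD : KCh D) (heD : Even D.card)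
    (h : KalLER (· ≤ ·) C D) : KalLER (· ≤ ·) (kalMapF f C) (kalMapF f D) := by
  rw [kal_le_iff hC heC hD heD] at h
  rw [kal_le_iff (kch_map hf hC) (kalMap_even f heC) (kch_map hf hD) (kalMap_even f heD)]
  obtain ⟨hU, hN⟩ := h
  constructor
  · refine kch_sub (kch_image hf hU) ?_
    rw [Finset.image_union]
    exact Finset.union_subset_union (kalMap_sub f C) (kalMap_sub f D)
  · intro y hy
    have hy1 : Odd (C.filter fun x => f x ≤ y).card := (kalMap_parity f C (fun z => z ≤ y)).1 hy
    refine (kalMap_parity f D (fun z => z ≤ y)).2 ?_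
    have hne : ((C ∪ D).filter fun x => f x ≤ y).Nonempty :=
      (odd_card_nonempty hy1).mono
        (Finset.filter_subset_filter _ Finset.subset_union_left)
    obtain ⟨m, hm, hmax⟩ := kch_max (kch_sub hU (Finset.filter_subset _ _)) hne
    rw [Finset.mem_filter] at hm
    have key : ∀ E : Finset α, E ⊆ C ∪ D →
        E.filter (fun x => f x ≤ y) = E.filter (fun x => x ≤ m) := by
      intro E hE
      apply Finset.filter_congr
      intro c hc
      exact ⟨fun h1 => hmax c (Finset.mem_filter.2 ⟨hE hc, h1⟩),
        fun h1 => (hf h1).trans hm.2⟩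
    rw [key C Finset.subset_union_left] at hy1
    rw [key D Finset.subset_union_right]
    exact hN m hy1

lemma kalMap_bt {α : Type u} {β : Type v} [PartialOrder α] [BoundedOrder α] [Nontrivial α]
    [PartialOrder β] [BoundedOrder β] [Nontrivial β] {f : α → β}
    (h0 : f ⊥ = ⊥) (h1 : f ⊤ = ⊤) :
    kalMapF f ({⊥, ⊤} : Finset α) = {⊥, ⊤} := by
  have hne : (⊥ : β) ≠ ⊤ := bot_ne_top
  ext y
  rw [mem_kalMap, Finset.filter_insert, Finset.filter_singleton, h0, h1]
  simp only [Finset.mem_insert, Finset.mem_singleton]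
  by_cases hy : ⊥ = y
  · subst hy
    simp [hne.symm]
  · by_cases hy2 : ⊤ = y
    · subst hy2
      simp [hne]
    · simp [hy, hy2, Ne.symm hy, Ne.symm hy2]

lemma kal_antisymm {α : Type u} [PartialOrder α] {C D : Finset α}
    (hC : KCh C) (heC : Even C.card) (hD : KCh D) (heD : Even D.card)
    (h : KalLER (· ≤ ·) C D) (h' : KalLER (· ≤ ·) D C) : C = D := by
  rw [kal_le_iff hC heC hD heD] at h
  rw [kal_le_iff hD heD hC heC] at h'
  exact KN_ext fun x => ⟨h.2 x, h'.2 x⟩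

end Helpers

/-- For every morphism of bounded posets `f : P → Q`, the map
`K(f)(C) = Δ_{x ∈ C} {f x}` is a morphism of orthomodular posets `K(P) → K(Q)`,
and `K` is functorial: `K(id) = id` and `K(g ∘ f) = K(g) ∘ K(f)`. -/
theorem kalmbach_map_is_functorial
    {P : Type u} {Q : Type v} {R : Type w}
    [PartialOrder P] [BoundedOrder P] [Nontrivial P]
    [PartialOrder Q] [BoundedOrder Q] [Nontrivial Q]
    [PartialOrder R] [BoundedOrder R] [Nontrivial R]
    (f : P → Q) (hf : Monotone f ∧ f ⊥ = ⊥ ∧ f ⊤ = ⊤)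
    (g : Q → R) (hg : Monotone g ∧ g ⊥ = ⊥ ∧ g ⊤ = ⊤) :
    RelOMPHom (KalCarrier Set.univ ((· ≤ ·) : P → P → Prop)) (KalLER (· ≤ ·))
        (kalComplF (⊥ : P) ⊤) ({⊥, ⊤} : Finset P)
      (KalCarrier Set.univ ((· ≤ ·) : Q → Q → Prop)) (KalLER (· ≤ ·))
        (kalComplF (⊥ : Q) ⊤) ({⊥, ⊤} : Finset Q)
      (kalMapF f) ∧
    (∀ C ∈ KalCarrier Set.univ ((· ≤ ·) : P → P → Prop), kalMapF (id : P → P) C = C) ∧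
    (∀ C ∈ KalCarrier Set.univ ((· ≤ ·) : P → P → Prop),
        kalMapF (g ∘ f) C = kalMapF g (kalMapF f C)) := by
  obtain ⟨hm, h0, h1⟩ := hf
  have horth : ∀ a ∈ KalCarrier Set.univ ((· ≤ ·) : P → P → Prop),
      ∀ b ∈ KalCarrier Set.univ ((· ≤ ·) : P → P → Prop),
      KalLER (· ≤ ·) a (kalComplF (⊥ : P) ⊤ b) →
      KalLER (· ≤ ·) (kalMapF f a) (kalComplF (⊥ : Q) ⊤ (kalMapF f b)) := by
    intro a ha b hb hab
    rw [kal_mem] at ha hb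
    have h2 := kalMap_mono hm ha.1 ha.2 (kch_compl hb.1) (even_compl hb.2) hab
    unfold kalComplF at h2 ⊢
    rwa [kalMap_symmDiff, kalMap_bt h0 h1] at h2
  refine ⟨⟨?_, kalMap_bt h0 h1, horth, ?_⟩, ?_, ?_⟩
  · intro C hC
    rw [kal_mem] at hC ⊢
    exact ⟨kch_map hm hC.1, kalMap_even f hC.2⟩
  · intro a ha b hb hab j hj
    have ho := horth a ha b hb hab
    rw [kal_mem] at ha hb
    have hs := kal_sup ha.1 ha.2 hb.1 hb.2 hab
    have hje : j = symmDiff a b := by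
      have hjm := kal_mem.1 hj.1
      have hsm := kal_mem.1 hs.1
      exact kal_antisymm hjm.1 hjm.2 hsm.1 hsm.2 (hj.2.2.2 _ hs.1 hs.2.1 hs.2.2.1)
        (hs.2.2.2 _ hj.1 hj.2.1 hj.2.2.1)
    rw [hje, kalMap_symmDiff]
    exact kal_sup (kch_map hm ha.1) (kalMap_even f ha.2) (kch_map hm hb.1) (kalMap_even f hb.2) ho
  · intro C _
    ext y
    rw [mem_kalMap]
    have e : C.filter (fun x => id x = y) = if y ∈ C then {y} else ∅ := by
      ext x
      by_cases hy : y ∈ C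
      · simp only [hy, if_true, Finset.mem_filter, Finset.mem_singleton, id]
        exact ⟨fun h => h.2, fun h => ⟨h ▸ hy, h⟩⟩
      · simp only [hy, if_false, Finset.mem_filter, Finset.notMem_empty, id, iff_false]
        rintro ⟨h2, rfl⟩
        exact hy h2
    rw [e]
    by_cases hy : y ∈ C <;> simp [hy]
  · intro C _
    ext z
    rw [mem_kalMap, mem_kalMap, kalMap_parity]
    rfl
end

section
/- The Kalmbach functor K : BPos → OMP is left adjoint to the forgetful functor U : OMP → BPos, with unit η : Id → UK given by η_P(0)=∅ and η_P(a)=[0<a] for a>0, and counit ε : KU → Id given by ε_L([x₁<…<x_{2n}]) = (x₁^⊥ ∧ x₂) ∨ … ∨ (x_{2n-1}^⊥ ∧ x_{2n}). -/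
attribute [local instance] Classical.propDecidable

universe u v w

/-- An orthomodular poset structure on a bounded poset `A`, given by an
orthocomplementation `oc`. -/
structure IsOMP (A : Type u) [PartialOrder A] [BoundedOrder A] (oc : A → A) : Prop where
  compl_anti : ∀ {x y : A}, x ≤ y → oc y ≤ oc x
  compl_compl : ∀ x : A, oc (oc x) = x
  inf_compl : ∀ x : A, IsGLB {x, oc x} (⊥ : A)
  sup_of_orth : ∀ x y : A, x ≤ oc y → ∃ j, IsLUB {x, y} j
  orthomodular : ∀ x y : A, x ≤ y → ∃ j, IsLUB {x, oc y} j ∧ IsLUB {x, oc j} y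

/-- `g : K(P) → A` is a morphism of orthomodular posets from the Kalmbach extension
of the bounded poset `P` to the orthomodular poset `A`. -/
def KalHomTo (P : Type u) (A : Type v) [PartialOrder P] [BoundedOrder P]
    [PartialOrder A] [BoundedOrder A] (oc : A → A) (g : Finset P → A) : Prop :=
  g ({⊥, ⊤} : Finset P) = ⊤ ∧
  ∀ C ∈ KalCarrier Set.univ ((· ≤ ·) : P → P → Prop),
    ∀ D ∈ KalCarrier Set.univ ((· ≤ ·) : P → P → Prop),
      KalLER (· ≤ ·) C (kalComplF (⊥ : P) ⊤ D) →
        g C ≤ oc (g D) ∧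
        ∀ J, RelLUB (KalCarrier Set.univ ((· ≤ ·) : P → P → Prop)) (KalLER (· ≤ ·)) C D J →
          IsLUB {g C, g D} (g J)

namespace Kal

def Chn {α : Type u} [PartialOrder α] (C : Finset α) : Prop :=
  ∀ a ∈ C, ∀ b ∈ C, a ≤ b ∨ b ≤ a

def chi {α : Type u} [PartialOrder α] (C : Finset α) (p : α) : Prop :=
  Odd (C.filter fun y => y ≤ p).card

def Cov {α : Type u} [PartialOrder α] (T : Finset α) (a b : α) : Prop :=
  a ∈ T ∧ b ∈ T ∧ a ≤ b ∧ a ≠ b ∧ ∀ c ∈ T, a ≤ c → c ≠ a → b ≤ c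

section order
variable {α : Type u} [PartialOrder α]

theorem pair_iff {C : Finset α} {a b : α} :
    KalPairR (· ≤ ·) C a b ↔ Cov C a b ∧ chi C a := by
  unfold KalPairR Cov chi; tauto

theorem Chn.sub {C D : Finset α} (h : Chn D) (hs : C ⊆ D) : Chn C :=
  fun a ha b hb => h a (hs ha) b (hs hb)

theorem exists_max {C : Finset α} (h : Chn C) (hn : C.Nonempty) :
    ∃ m ∈ C, ∀ y ∈ C, y ≤ m := by
  obtain ⟨m, hm⟩ := C.exists_maximal hn
  refine ⟨m, hm.1, fun y hy => ?_⟩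
  rcases h y hy m hm.1 with h1 | h1
  · exact h1
  · exact hm.2 hy h1

theorem exists_min {C : Finset α} (h : Chn C) (hn : C.Nonempty) :
    ∃ m ∈ C, ∀ y ∈ C, m ≤ y := by
  obtain ⟨m, hm⟩ := C.exists_minimal hn
  refine ⟨m, hm.1, fun y hy => ?_⟩
  rcases h y hy m hm.1 with h1 | h1
  · exact hm.2 hy h1
  · exact h1

theorem chi_symmDiff (C D : Finset α) (p : α) :
    chi (symmDiff C D) p ↔ ¬ (chi C p ↔ chi D p) := by
  unfold chi
  have h1 : (symmDiff C D).filter (fun y => y ≤ p) =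
      symmDiff (C.filter fun y => y ≤ p) (D.filter fun y => y ≤ p) := by
    ext y; simp only [Finset.mem_filter, Finset.mem_symmDiff]; tauto
  rw [h1]
  generalize (C.filter fun y => y ≤ p) = X
  generalize (D.filter fun y => y ≤ p) = Y
  have h2 : (symmDiff X Y).card = (X \ Y).card + (Y \ X).card := by
    rw [symmDiff_def, Finset.sup_eq_union, Finset.card_union_of_disjoint]
    exact disjoint_sdiff_sdiff
  have h3 := Finset.card_sdiff_add_card_inter X Y
  have h4 := Finset.card_sdiff_add_card_inter Y X
  rw [Finset.inter_comm] at h4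
  simp only [Nat.odd_iff]
  omega

theorem exists_pair {C : Finset α} (h : Chn C) (he : Even C.card) {s : α} (hs : chi C s) :
    ∃ a b, Cov C a b ∧ chi C a ∧ a ≤ s ∧ ¬ b ≤ s := by
  have hne : (C.filter fun y => y ≤ s).Nonempty := by
    rw [← Finset.card_pos]; exact hs.pos
  obtain ⟨a, ha, hmax⟩ := exists_max (h.sub (Finset.filter_subset _ _)) hne
  have hne2 : (C.filter fun y => ¬ y ≤ s).Nonempty := by
    rw [← Finset.card_pos]
    by_contra h0
    have := Finset.card_filter_add_card_filter_not (s := C) (fun y => y ≤ s)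
    unfold chi at hs
    rw [Nat.odd_iff] at hs
    rw [Nat.even_iff] at he
    omega
  obtain ⟨b, hb, hmin⟩ := exists_min (h.sub (Finset.filter_subset _ _)) hne2
  simp only [Finset.mem_filter] at ha hb hmax hmin
  refine ⟨a, b, ⟨ha.1, hb.1, ?_, ?_, ?_⟩, ?_, ha.2, hb.2⟩
  · rcases h a ha.1 b hb.1 with h1 | h1
    · exact h1
    · exact absurd (h1.trans ha.2) hb.2
  · rintro rfl; exact hb.2 ha.2
  · intro c hc hac hne
    refine hmin c ⟨hc, fun hcs => hne (le_antisymm (hmax c ⟨hc, hcs⟩) hac)⟩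
  · unfold chi at hs ⊢
    convert hs using 2
    ext y
    simp only [Finset.mem_filter]
    exact ⟨fun hy => ⟨hy.1, hy.2.trans ha.2⟩, fun hy => ⟨hy.1, hmax y hy⟩⟩

theorem Cov.chi_of {C : Finset α} (h : Chn C) {a b p : α} (hc : Cov C a b) (ha : chi C a)
    (hap : a ≤ p) (hbp : ¬ b ≤ p) : chi C p := by
  unfold chi at ha ⊢
  convert ha using 2
  ext y
  simp only [Finset.mem_filter]
  refine ⟨fun hy => ⟨hy.1, ?_⟩, fun hy => ⟨hy.1, hy.2.trans hap⟩⟩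
  rcases h y hy.1 a hc.1 with h1 | h1
  · exact h1
  · by_cases hya : y = a
    · exact hya.le
    · exact absurd ((hc.2.2.2.2 y hy.1 h1 hya).trans hy.2) hbp

theorem filter_cov {C : Finset α} (h : Chn C) {a b : α} (hc : Cov C a b) :
    (C.filter fun y => y ≤ b).card = (C.filter fun y => y ≤ a).card + 1 := by
  have : (C.filter fun y => y ≤ b) = insert b (C.filter fun y => y ≤ a) := by
    ext y
    simp only [Finset.mem_filter, Finset.mem_insert]
    constructor
    · rintro ⟨h1, h2⟩
      rcases h y h1 a hc.1 with h3 | h3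
      · exact Or.inr ⟨h1, h3⟩
      · by_cases hya : y = a
        · exact Or.inr ⟨h1, hya.le⟩
        · exact Or.inl (le_antisymm h2 (hc.2.2.2.2 y h1 h3 hya))
    · rintro (rfl | ⟨h1, h2⟩)
      · exact ⟨hc.2.1, le_rfl⟩
      · exact ⟨h1, h2.trans hc.2.2.1⟩
  rw [this, Finset.card_insert_of_notMem]
  simp only [Finset.mem_filter, not_and]
  intro _ h2
  exact hc.2.2.2.1 (le_antisymm hc.2.2.1 h2)

theorem chi_cov {C : Finset α} (h : Chn C) {a b : α} (hc : Cov C a b) :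
    chi C b ↔ ¬ chi C a := by
  unfold chi; rw [filter_cov h hc, Nat.odd_add_one]

theorem exists_pred {T : Finset α} (h : Chn T) {a t : α} (ha : a ∈ T) (ht : t ∈ T)
    (hat : a ≤ t) (hne : a ≠ t) : ∃ s, Cov T s t ∧ a ≤ s := by
  obtain ⟨s, hs, hmax⟩ := exists_max (h.sub (Finset.filter_subset (fun y => y ≤ t ∧ y ≠ t) _))
    ⟨a, by simp [ha, hat, hne]⟩
  simp only [Finset.mem_filter] at hs hmax
  refine ⟨s, ⟨hs.1, ht, hs.2.1, hs.2.2, ?_⟩, hmax a ⟨ha, hat, hne⟩⟩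
  intro c hc hsc hcs
  rcases h c hc t ht with h1 | h1
  · by_cases hct : c = t
    · exact hct.ge
    · exact absurd (le_antisymm (hmax c ⟨hc, h1, hct⟩) hsc) hcs
  · exact h1

theorem mem_pair {C : Finset α} (h : Chn C) (he : Even C.card) {x : α} (hx : x ∈ C) :
    ∃ a b, Cov C a b ∧ chi C a ∧ a ≤ x ∧ x ≤ b := by
  by_cases hc : chi C x
  · obtain ⟨a, b, hab, hca, hax, hbx⟩ := exists_pair h he hc
    refine ⟨a, b, hab, hca, hax, ?_⟩
    rcases h x hx b hab.2.1 with h1 | h1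
    · exact h1
    · exact absurd h1 hbx
  · have : ∃ y ∈ C, y ≤ x ∧ y ≠ x := by
      by_contra hn
      push Not at hn
      apply hc
      have : (C.filter fun y => y ≤ x) = {x} := by
        ext y
        simp only [Finset.mem_filter, Finset.mem_singleton]
        constructor
        · exact fun hy => hn y hy.1 hy.2
        · rintro rfl; exact ⟨hx, le_rfl⟩
      unfold chi
      rw [this]; simp
    obtain ⟨y, hy, hyx, hne⟩ := this
    obtain ⟨s, hs, -⟩ := exists_pred h hy hx hyx hne
    have := chi_cov h hs
    exact ⟨s, x, hs, by tauto, hs.2.2.1, le_rfl⟩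

theorem le_chi {C D : Finset α} (hC : Chn C) (hCe : Even C.card) (hD : Chn D)
    (h : KalLER (· ≤ ·) C D) {p : α} (hp : chi C p) : chi D p := by
  obtain ⟨a, b, hab, hca, hax, hbx⟩ := exists_pair hC hCe hp
  obtain ⟨c, d, hcd, h1, h2⟩ := h a b (pair_iff.2 ⟨hab, hca⟩)
  rw [pair_iff] at hcd
  exact hcd.1.chi_of hD hcd.2 (h1.trans hax) (fun h3 => hbx (h2.trans h3))

theorem le_cmp {C D : Finset α} (hC : Chn C) (hCe : Even C.card) (hD : Chn D)
    (h : KalLER (· ≤ ·) C D) {x y : α} (hx : x ∈ C) (hy : y ∈ D) : x ≤ y ∨ y ≤ x := by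
  obtain ⟨a, b, hab, hca, hax, hbx⟩ := mem_pair hC hCe hx
  obtain ⟨c, d, hcd, h1, h2⟩ := h a b (pair_iff.2 ⟨hab, hca⟩)
  rw [pair_iff] at hcd
  rcases hD y hy c hcd.1.1 with h3 | h3
  · exact Or.inr (h3.trans (h1.trans hax))
  · by_cases hyc : y = c
    · exact Or.inr (hyc.le.trans (h1.trans hax))
    · exact Or.inl (hbx.trans (h2.trans (hcd.1.2.2.2.2 y hy h3 hyc)))

theorem chn_union {C D : Finset α} (hC : Chn C) (hD : Chn D)
    (h : ∀ x ∈ C, ∀ y ∈ D, x ≤ y ∨ y ≤ x) : Chn (C ∪ D) := by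
  intro x hx y hy
  rw [Finset.mem_union] at hx hy
  rcases hx with hx | hx <;> rcases hy with hy | hy
  · exact hC x hx y hy
  · exact h x hx y hy
  · exact (h y hy x hx).symm
  · exact hD x hx y hy

theorem symm_sub (C D : Finset α) : symmDiff C D ⊆ C ∪ D := by
  intro x; simp only [Finset.mem_symmDiff, Finset.mem_union]; tauto

theorem le_of_chi {C D : Finset α} (hT : Chn (C ∪ D)) (hDe : Even D.card)
    (h : ∀ p, chi C p → chi D p) : KalLER (· ≤ ·) C D := by
  have hC := hT.sub Finset.subset_union_left
  have hD := hT.sub Finset.subset_union_right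
  intro a b hab
  rw [pair_iff] at hab
  obtain ⟨hab, ha⟩ := hab
  obtain ⟨c, d, hcd, hc, hca, hda⟩ := exists_pair hD hDe (h a ha)
  refine ⟨c, d, pair_iff.2 ⟨hcd, hc⟩, hca, ?_⟩
  by_contra hbd
  have had : a ≤ d := (hT a (Finset.mem_union_left _ hab.1) d
    (Finset.mem_union_right _ hcd.2.1)).resolve_right hda
  have := h d (hab.chi_of hC ha had hbd)
  have := chi_cov hD hcd
  tauto

theorem eq_of_chi {C D : Finset α} (hT : Chn (C ∪ D)) (h : ∀ p, chi C p ↔ chi D p) : C = D := by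
  by_contra hne
  have hE := hT.sub (symm_sub C D)
  have hn : (symmDiff C D).Nonempty := by
    rw [Finset.nonempty_iff_ne_empty]
    intro h0
    exact hne (symmDiff_eq_bot.1 h0)
  obtain ⟨m, hm, hmin⟩ := exists_min hE hn
  have h1 := (chi_symmDiff C D m).not.2 (not_not.2 (h m))
  apply h1
  have : ((symmDiff C D).filter fun y => y ≤ m) = {m} := by
    ext y
    simp only [Finset.mem_filter, Finset.mem_singleton]
    constructor
    · exact fun hy => le_antisymm hy.2 (hmin y hy.1)
    · rintro rfl; exact ⟨hm, le_rfl⟩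
  unfold chi
  rw [this]; simp

theorem chi_pair {a b : α} (hab : a ≤ b) (hne : a ≠ b) (p : α) :
    chi ({a, b} : Finset α) p ↔ a ≤ p ∧ ¬ b ≤ p := by
  unfold chi
  by_cases h1 : b ≤ p
  · have h2 := hab.trans h1
    rw [Finset.filter_true_of_mem (by simp [h1, h2]), Finset.card_pair hne]
    simp [h1]
  · by_cases h2 : a ≤ p
    · have : (({a, b} : Finset α).filter fun y => y ≤ p) = {a} := by
        ext y; simp only [Finset.mem_filter, Finset.mem_insert, Finset.mem_singleton]
        constructor
        · rintro ⟨rfl | rfl, h3⟩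
          · rfl
          · exact absurd h3 h1
        · rintro rfl; exact ⟨Or.inl rfl, h2⟩
      rw [this]; simp [h1, h2]
    · rw [Finset.filter_false_of_mem (by simp [h1, h2])]; simp [h2]

theorem chn_pair {a b : α} (hab : a ≤ b) : Chn ({a, b} : Finset α) := by
  intro x hx y hy
  simp only [Finset.mem_insert, Finset.mem_singleton] at hx hy
  rcases hx with rfl | rfl <;> rcases hy with rfl | rfl <;> simp [hab]

end order

abbrev KC (P : Type u) [PartialOrder P] : Set (Finset P) :=
  KalCarrier Set.univ ((· ≤ ·) : P → P → Prop)

theorem mem_KC {P : Type u} [PartialOrder P] {C : Finset P} :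
    C ∈ KC P ↔ Chn C ∧ Even C.card := by
  simp [KC, KalCarrier, IsEvenChainR, Chn]

section bounded
variable {P : Type u} [PartialOrder P] [BoundedOrder P] 

theorem even_iff (C : Finset P) : Even C.card ↔ ¬ chi C ⊤ := by
  unfold chi
  rw [Finset.filter_true_of_mem (by simp), Nat.not_odd_iff_even]

theorem symm_mem {C D : Finset P} (hC : C ∈ KC P) (hD : D ∈ KC P) (hT : Chn (C ∪ D)) :
    symmDiff C D ∈ KC P := by
  rw [mem_KC] at *
  refine ⟨hT.sub (symm_sub _ _), ?_⟩
  have h1 := (even_iff C).1 hC.2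
  have h2 := (even_iff D).1 hD.2
  rw [even_iff, chi_symmDiff]; tauto

theorem lub_symm {C D : Finset P} (hC : C ∈ KC P) (hD : D ∈ KC P) (hT : Chn (C ∪ D))
    (hd : ∀ p, chi C p → ¬ chi D p) :
    RelLUB (KC P) (KalLER (· ≤ ·)) C D (symmDiff C D) := by
  have hJ := symm_mem hC hD hT
  have hJ' := mem_KC.1 hJ
  have hC' := mem_KC.1 hC
  have hD' := mem_KC.1 hD
  refine ⟨hJ, ?_, ?_, ?_⟩
  · refine le_of_chi (hT.sub (Finset.union_subset Finset.subset_union_left (symm_sub _ _)))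
      hJ'.2 fun p hp => ?_
    have := hd p
    rw [chi_symmDiff]; tauto
  · refine le_of_chi (hT.sub (Finset.union_subset Finset.subset_union_right (symm_sub _ _)))
      hJ'.2 fun p hp => ?_
    have := hd p
    rw [chi_symmDiff]; tauto
  · intro W hW h1 h2
    have hW' := mem_KC.1 hW
    refine le_of_chi (chn_union hJ'.1 hW'.1 ?_) hW'.2 fun p hp => ?_
    · intro x hx y hy
      rcases Finset.mem_union.1 (symm_sub _ _ hx) with h | h
      · exact le_cmp hC'.1 hC'.2 hW'.1 h1 h hy
      · exact le_cmp hD'.1 hD'.2 hW'.1 h2 h hy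
    · have h3 := le_chi hC'.1 hC'.2 hW'.1 h1 (p := p)
      have h4 := le_chi hD'.1 hD'.2 hW'.1 h2 (p := p)
      rw [chi_symmDiff] at hp; tauto

theorem lub_unique {C D J J' : Finset P}
    (h : RelLUB (KC P) (KalLER (· ≤ ·)) C D J) (h' : RelLUB (KC P) (KalLER (· ≤ ·)) C D J') :
    J = J' := by
  have h1 := h.2.2.2 J' h'.1 h'.2.1 h'.2.2.1
  have h2 := h'.2.2.2 J h.1 h.2.1 h.2.2.1
  have hJ := mem_KC.1 h.1
  have hJ' := mem_KC.1 h'.1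
  refine eq_of_chi (chn_union hJ.1 hJ'.1 fun x hx y hy => le_cmp hJ.1 hJ.2 hJ'.1 h1 hx hy) ?_
  exact fun p => ⟨le_chi hJ.1 hJ.2 hJ'.1 h1, le_chi hJ'.1 hJ'.2 hJ.1 h2⟩

variable [Nontrivial P]

theorem top_mem_KC : ({⊥, ⊤} : Finset P) ∈ KC P :=
  mem_KC.2 ⟨chn_pair bot_le, by rw [Finset.card_pair bot_ne_top]; decide⟩

theorem chn_compl {D : Finset P} (hD : Chn D) : Chn (D ∪ {⊥, ⊤}) := by
  refine chn_union hD (chn_pair bot_le) fun x _ y hy => ?_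
  simp only [Finset.mem_insert, Finset.mem_singleton] at hy
  rcases hy with rfl | rfl <;> simp

theorem compl_mem {D : Finset P} (hD : D ∈ KC P) : kalComplF (⊥ : P) ⊤ D ∈ KC P :=
  symm_mem hD top_mem_KC (chn_compl (mem_KC.1 hD).1)

theorem chi_compl (D : Finset P) (p : P) :
    chi (kalComplF (⊥ : P) ⊤ D) p ↔ (p ≠ ⊤ ∧ ¬ chi D p) ∨ (p = ⊤ ∧ chi D p) := by
  unfold kalComplF
  rw [chi_symmDiff, chi_pair bot_le bot_ne_top]
  simp only [bot_le, true_and, top_le_iff]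
  tauto

theorem orth_iff {C D : Finset P} (hC : C ∈ KC P) (hD : D ∈ KC P) :
    KalLER (· ≤ ·) C (kalComplF (⊥ : P) ⊤ D) ↔
      Chn (C ∪ D) ∧ ∀ p, chi C p → ¬ chi D p := by
  have hK := mem_KC.1 (compl_mem hD)
  have hC' := mem_KC.1 hC
  have hD' := mem_KC.1 hD
  have hCt : ∀ p, chi C p → p ≠ ⊤ := by
    rintro p hp rfl
    exact (even_iff C).1 hC'.2 hp
  constructor
  · intro h
    refine ⟨chn_union hC'.1 hD'.1 fun x hx y hy => ?_, fun p hp => ?_⟩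
    · by_cases hy2 : y ∈ ({⊥, ⊤} : Finset P)
      · simp only [Finset.mem_insert, Finset.mem_singleton] at hy2
        rcases hy2 with rfl | rfl <;> simp
      · exact le_cmp hC'.1 hC'.2 hK.1 h hx (Finset.mem_symmDiff.2 (Or.inl ⟨hy, hy2⟩))
    · have h1 := le_chi hC'.1 hC'.2 hK.1 h hp
      have := hCt p hp
      rw [chi_compl] at h1; tauto
  · rintro ⟨hT, hd⟩
    refine le_of_chi ((chn_compl hT).sub ?_) hK.2 fun p hp => ?_
    · intro x
      unfold kalComplF
      simp only [Finset.mem_union, Finset.mem_symmDiff]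
      tauto
    · have := hCt p hp
      have := hd p hp
      rw [chi_compl]; tauto

end bounded

section omp
variable {A : Type v} [PartialOrder A] [BoundedOrder A] {oc : A → A}

theorem le_oc (hA : IsOMP A oc) {x y : A} (h : x ≤ oc y) : y ≤ oc x := by
  have := hA.compl_anti h
  rwa [hA.compl_compl] at this

theorem lub_pair {x y z : A} : IsLUB {x, y} z ↔ x ≤ z ∧ y ≤ z ∧ ∀ w, x ≤ w → y ≤ w → z ≤ w := by
  simp [IsLUB, IsLeast, mem_upperBounds, mem_lowerBounds, and_assoc]

theorem glb_pair {x y z : A} : IsGLB {x, y} z ↔ z ≤ x ∧ z ≤ y ∧ ∀ w, w ≤ x → w ≤ y → w ≤ z := by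
  simp [IsGLB, IsGreatest, mem_upperBounds, mem_lowerBounds, and_assoc]

theorem eq_bot (hA : IsOMP A oc) {x z : A} (h1 : z ≤ x) (h2 : z ≤ oc x) : z = ⊥ :=
  le_bot_iff.1 ((glb_pair.1 (hA.inf_compl x)).2.2 z h1 h2)

theorem exists_df (hA : IsOMP A oc) {a b : A} (h : a ≤ b) :
    ∃ w, IsGLB {oc a, b} w ∧ IsLUB {a, w} b := by
  obtain ⟨j, h1, h2⟩ := hA.orthomodular a b h
  refine ⟨oc j, ?_, h2⟩
  rw [lub_pair] at h1 h2
  rw [glb_pair]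
  refine ⟨hA.compl_anti h1.1, h2.2.1, fun w hw1 hw2 => ?_⟩
  exact le_oc hA (h1.2.2 _ (le_oc hA hw1) (hA.compl_anti hw2))

noncomputable def df (oc : A → A) (a b : A) : A :=
  if h : ∃ w, IsGLB {oc a, b} w then h.choose else ⊥

theorem df_glb (hA : IsOMP A oc) {a b : A} (h : a ≤ b) : IsGLB {oc a, b} (df oc a b) := by
  have h1 : ∃ w, IsGLB {oc a, b} w := let ⟨w, hw, _⟩ := exists_df hA h; ⟨w, hw⟩
  unfold df
  rw [dif_pos h1]
  exact h1.choose_spec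

theorem df_lub (hA : IsOMP A oc) {a b : A} (h : a ≤ b) : IsLUB {a, df oc a b} b := by
  obtain ⟨w, hw, h2⟩ := exists_df hA h
  rwa [(df_glb hA h).unique hw]

theorem df_unique (hA : IsOMP A oc) {x y z : A} (h : x ≤ oc y) (hl : IsLUB {x, y} z) :
    x = df oc y z := by
  rw [lub_pair] at hl
  have hw := glb_pair.1 (df_glb hA hl.2.1)
  have hxw := hw.2.2 x h hl.1
  obtain ⟨u, hu, hu2⟩ := exists_df hA hxw
  rw [glb_pair] at hu
  have h3 : u ≤ oc z := le_oc hA (hl.2.2 _ (le_oc hA hu.1)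
    (le_oc hA (hu.2.1.trans hw.1)))
  have h4 := eq_bot hA (hu.2.1.trans hw.2.1) h3
  rw [lub_pair] at hu2
  refine le_antisymm hxw (hu2.2.2 x le_rfl ?_)
  rw [h4]; exact bot_le

theorem df_le_right (hA : IsOMP A oc) {a b : A} (h : a ≤ b) : df oc a b ≤ b :=
  (glb_pair.1 (df_glb hA h)).2.1

theorem df_le_oc (hA : IsOMP A oc) {a b : A} (h : a ≤ b) : df oc a b ≤ oc a :=
  (glb_pair.1 (df_glb hA h)).1

theorem df_self (hA : IsOMP A oc) (a : A) : df oc a a = ⊥ :=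
  eq_bot hA (df_le_right hA le_rfl) (df_le_oc hA le_rfl)

theorem df_bot (hA : IsOMP A oc) (a : A) : df oc ⊥ a = a := by
  refine (df_unique hA (le_oc hA bot_le) ?_).symm
  rw [lub_pair]; simp

theorem df_mono (hA : IsOMP A oc) {a b c d : A} (h1 : a ≤ b) (h2 : b ≤ c) (h3 : c ≤ d) :
    df oc b c ≤ df oc a d :=
  (glb_pair.1 (df_glb hA (h1.trans (h2.trans h3)))).2.2 _
    ((df_le_oc hA h2).trans (hA.compl_anti h1)) ((df_le_right hA h2).trans h3)

/-- if `w` bounds the two differences, it bounds their sum -/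
theorem df_add (hA : IsOMP A oc) {a b c w : A} (h1 : a ≤ b) (h2 : b ≤ c)
    (hw1 : df oc a b ≤ w) (hw2 : df oc b c ≤ w) : df oc a c ≤ w := by
  have ho : df oc a b ≤ oc (df oc b c) :=
    le_oc hA ((df_le_oc hA h2).trans (hA.compl_anti (df_le_right hA h1)))
  obtain ⟨j, hj⟩ := hA.sup_of_orth _ _ ho
  have hj' := lub_pair.1 hj
  have : j = df oc a c := by
    apply df_unique hA
    · refine hj'.2.2 _ (df_le_oc hA h1) ((df_le_oc hA h2).trans (hA.compl_anti h1))
    · rw [lub_pair]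
      refine ⟨hj'.2.2 _ ((df_le_right hA h1).trans h2) (df_le_right hA h2), h1.trans h2, ?_⟩
      intro v hv1 hv2
      refine (lub_pair.1 (df_lub hA h2)).2.2 v ?_ (hj'.2.1.trans hv1)
      exact (lub_pair.1 (df_lub hA h1)).2.2 v hv2 (hj'.1.trans hv1)
  rw [← this]
  exact hj'.2.2 _ hw1 hw2

theorem exists_lub (hA : IsOMP A oc) {S : Set A} (hS : S.Finite)
    (ho : ∀ x ∈ S, ∀ y ∈ S, x ≠ y → x ≤ oc y) : ∃ j, IsLUB S j := by
  induction S, hS using Set.Finite.induction_on with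
  | empty => exact ⟨⊥, isLUB_empty⟩
  | @insert a S ha hS ih =>
    obtain ⟨j, hj⟩ := ih fun x hx y hy => ho x (Or.inr hx) y (Or.inr hy)
    have : j ≤ oc a := hj.2 fun x hx => ho x (Or.inr hx) a (Or.inl rfl)
      (by rintro rfl; exact ha hx)
    obtain ⟨k, hk⟩ := hA.sup_of_orth j a this
    rw [lub_pair] at hk
    refine ⟨k, ?_, fun w hw => hk.2.2 w (hj.2 fun x hx => hw (Or.inr hx)) (hw (Or.inl rfl))⟩
    rintro x (rfl | hx)
    · exact hk.2.1
    · exact (hj.1 hx).trans hk.1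

variable {P : Type u} [PartialOrder P]

def V (oc : A → A) (f : P → A) (T C : Finset P) : Set A :=
  {w | ∃ a b, Cov T a b ∧ chi C a ∧ w = df oc (f a) (f b)}

theorem V_finite (f : P → A) (T C : Finset P) : (V oc f T C).Finite := by
  refine ((T ×ˢ T).finite_toSet.image fun q => df oc (f q.1) (f q.2)).subset ?_
  rintro w ⟨a, b, h, -, rfl⟩
  exact ⟨(a, b), by simp [h.1, h.2.1], rfl⟩

theorem V_orth (hA : IsOMP A oc) {f : P → A} (hf : Monotone f) {T : Finset P} (hT : Chn T)
    {a b c d : P} (h1 : Cov T a b) (h2 : Cov T c d) (hne : a ≠ c) :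
    df oc (f a) (f b) ≤ oc (df oc (f c) (f d)) := by
  rcases hT a h1.1 c h2.1 with h | h
  · have h3 := h1.2.2.2.2 c h2.1 h hne.symm
    exact (df_le_right hA (hf h1.2.2.1)).trans
      ((hf h3).trans (le_oc hA (df_le_oc hA (hf h2.2.2.1))))
  · have h3 := h2.2.2.2.2 a h1.1 h hne
    exact le_oc hA ((df_le_right hA (hf h2.2.2.1)).trans
      ((hf h3).trans (le_oc hA (df_le_oc hA (hf h1.2.2.1)))))

theorem Cov.unique {T : Finset P} {a b c : P} (h1 : Cov T a b) (h2 : Cov T a c) : b = c :=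
  le_antisymm (h1.2.2.2.2 c h2.2.1 h2.2.2.1 h2.2.2.2.1.symm)
    (h2.2.2.2.2 b h1.2.1 h1.2.2.1 h1.2.2.2.1.symm)

theorem V_lub (hA : IsOMP A oc) {f : P → A} (hf : Monotone f) {T : Finset P} (hT : Chn T)
    (C : Finset P) : ∃ j, IsLUB (V oc f T C) j := by
  refine exists_lub hA (V_finite f T C) ?_
  rintro x ⟨a, b, h1, -, rfl⟩ y ⟨c, d, h2, -, rfl⟩ hne
  refine V_orth hA hf hT h1 h2 ?_
  rintro rfl
  rw [h1.unique h2] at hne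
  exact hne rfl

theorem V_refine (hA : IsOMP A oc) {f : P → A} (hf : Monotone f) {T C : Finset P} (hT : Chn T)
    (hs : C ⊆ T) (hCe : Even C.card) : upperBounds (V oc f T C) = upperBounds (V oc f C C) := by
  have hC := hT.sub hs
  ext w
  constructor
  · rintro hw _ ⟨a, b, hab, hca, rfl⟩
    have key : ∀ n : ℕ, ∀ t ∈ T, (T.filter fun y => y ≤ t).card = n → a ≤ t → t ≤ b →
        df oc (f a) (f t) ≤ w := by
      intro n
      induction n with
      | zero =>
        intro t ht h0
        rw [Finset.card_eq_zero] at h0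
        have : t ∈ T.filter fun y => y ≤ t := by simp [ht]
        rw [h0] at this
        simp at this
      | succ n ih =>
        intro t ht hn hat htb
        by_cases hne : a = t
        · subst hne
          rw [df_self hA]; exact bot_le
        · obtain ⟨s, hst, has⟩ := exists_pred hT (hs hab.1) ht hat hne
          have hbs : ¬ b ≤ s := fun h =>
            hst.2.2.2.1 (le_antisymm hst.2.2.1 (htb.trans h))
          have h1 := filter_cov hT hst
          refine df_add hA (hf has) (hf hst.2.2.1)
            (ih s hst.1 (by omega) has (hst.2.2.1.trans htb)) (hw ?_)
          exact ⟨s, t, hst, hab.chi_of hC hca has hbs, rfl⟩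
    exact key _ b (hs hab.2.1) rfl hab.2.2.1 le_rfl
  · rintro hw _ ⟨s, t, hst, hcs, rfl⟩
    obtain ⟨a, b, hab, hca, has, hbs⟩ := exists_pair hC hCe hcs
    have hsb := (hT s hst.1 b (hs hab.2.1)).resolve_right hbs
    have htb := hst.2.2.2.2 b (hs hab.2.1) hsb (by rintro rfl; exact hbs le_rfl)
    exact (df_mono hA (hf has) (hf hst.2.2.1) (hf htb)).trans (hw ⟨a, b, hab, hca, rfl⟩)

noncomputable def gK (oc : A → A) (f : P → A) (C : Finset P) : A :=
  if h : ∃ j, IsLUB (V oc f C C) j then h.choose else ⊥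

theorem gK_lub (hA : IsOMP A oc) {f : P → A} (hf : Monotone f) {C : Finset P} (hC : Chn C) :
    IsLUB (V oc f C C) (gK oc f C) := by
  have h := V_lub hA hf hC C
  unfold gK
  rw [dif_pos h]
  exact h.choose_spec

theorem gK_lub' (hA : IsOMP A oc) {f : P → A} (hf : Monotone f) {T C : Finset P} (hT : Chn T)
    (hs : C ⊆ T) (hCe : Even C.card) : IsLUB (V oc f T C) (gK oc f C) := by
  unfold IsLUB
  rw [V_refine hA hf hT hs hCe]
  exact gK_lub hA hf (hT.sub hs)

variable [BoundedOrder P] [Nontrivial P]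

theorem gK_eta (hA : IsOMP A oc) {f : P → A} (hf : Monotone f) (h0 : f ⊥ = ⊥) (a : P) :
    gK oc f (kalEtaF ⊥ a) = f a := by
  unfold kalEtaF
  split_ifs with h
  · subst h
    have := gK_lub hA hf (C := (∅ : Finset P)) (by intro x hx; simp at hx)
    have h2 : V oc f (∅ : Finset P) ∅ = ∅ := by
      ext w; simp [V, Cov]
    rw [h2] at this
    rw [h0]
    exact this.unique isLUB_empty
  · have := gK_lub hA hf (C := ({⊥, a} : Finset P)) (chn_pair bot_le)
    have hne : (⊥ : P) ≠ a := fun e => h e.symm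
    have h2 : V oc f ({⊥, a} : Finset P) {⊥, a} = {f a} := by
      ext w
      simp only [V, Set.mem_setOf_eq, Set.mem_singleton_iff]
      constructor
      · rintro ⟨c, d, hc, hx, rfl⟩
        rw [chi_pair bot_le hne] at hx
        have h3 := hc.1
        have h4 := hc.2.1
        simp only [Finset.mem_insert, Finset.mem_singleton] at h3 h4
        rcases h3 with rfl | rfl
        · rcases h4 with rfl | rfl
          · exact absurd rfl hc.2.2.2.1
          · rw [h0, df_bot hA]
        · exact absurd le_rfl hx.2
      · rintro rfl
        refine ⟨⊥, a, ⟨by simp, by simp, bot_le, hne, ?_⟩, ?_, by rw [h0, df_bot hA]⟩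
        · intro c hc _ hcb
          simp only [Finset.mem_insert, Finset.mem_singleton] at hc
          rcases hc with rfl | rfl
          · exact absurd rfl hcb
          · exact le_rfl
        · rw [chi_pair bot_le hne]
          exact ⟨le_rfl, fun h5 => h (le_bot_iff.1 h5)⟩
    rw [h2] at this
    exact this.unique isLUB_singleton

theorem gK_hom (hA : IsOMP A oc) {f : P → A} (hf : Monotone f) (h0 : f ⊥ = ⊥) (h1 : f ⊤ = ⊤) :
    KalHomTo P A oc (gK oc f) := by
  constructor
  · have := gK_eta hA hf h0 ⊤
    rw [h1] at this
    rwa [kalEtaF, if_neg top_ne_bot] at this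
  · intro C hC D hD ho
    obtain ⟨hT, hd⟩ := (orth_iff hC hD).1 ho
    have hgC := gK_lub' hA hf hT Finset.subset_union_left (mem_KC.1 hC).2
    have hgD := gK_lub' hA hf hT Finset.subset_union_right (mem_KC.1 hD).2
    constructor
    · refine hgC.2 ?_
      rintro _ ⟨a, b, hab, ha, rfl⟩
      refine le_oc hA (hgD.2 ?_)
      rintro _ ⟨c, d, hcd, hc, rfl⟩
      refine V_orth hA hf hT hcd hab ?_
      rintro rfl
      exact hd _ ha hc
    · intro J hJ
      have := lub_unique hJ (lub_symm hC hD hT hd)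
      subst this
      have hgJ := gK_lub' hA hf hT (symm_sub C D) (mem_KC.1 hJ.1).2
      rw [lub_pair]
      refine ⟨hgC.2 ?_, hgD.2 ?_, fun w hw1 hw2 => hgJ.2 ?_⟩
      · rintro _ ⟨a, b, hab, ha, rfl⟩
        refine hgJ.1 ⟨a, b, hab, ?_, rfl⟩
        have := hd a
        rw [chi_symmDiff]; tauto
      · rintro _ ⟨a, b, hab, ha, rfl⟩
        refine hgJ.1 ⟨a, b, hab, ?_, rfl⟩
        have := hd a
        rw [chi_symmDiff]; tauto
      · rintro _ ⟨a, b, hab, ha, rfl⟩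
        rw [chi_symmDiff] at ha
        by_cases hCa : chi C a
        · exact (hgC.1 ⟨a, b, hab, hCa, rfl⟩).trans hw1
        · exact (hgD.1 ⟨a, b, hab, by tauto, rfl⟩).trans hw2

theorem hom_symm {g : Finset P → A} (hg : KalHomTo P A oc g) {C D : Finset P}
    (hC : C ∈ KC P) (hD : D ∈ KC P) (hT : Chn (C ∪ D)) (hd : ∀ p, chi C p → ¬ chi D p) :
    g C ≤ oc (g D) ∧ IsLUB {g C, g D} (g (symmDiff C D)) := by
  have := hg.2 C hC D hD ((orth_iff hC hD).2 ⟨hT, hd⟩)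
  exact ⟨this.1, this.2 _ (lub_symm hC hD hT hd)⟩

theorem pair_mem {a b : P} (hab : a ≤ b) (hne : a ≠ b) : ({a, b} : Finset P) ∈ KC P :=
  mem_KC.2 ⟨chn_pair hab, by rw [Finset.card_pair hne]; decide⟩

theorem hom_pair (hA : IsOMP A oc) {g : Finset P → A} (hg : KalHomTo P A oc g) {f : P → A}
    (h0 : f ⊥ = ⊥) (hf : ∀ a, g (kalEtaF ⊥ a) = f a) {a b : P} (hab : a ≤ b) (hne : a ≠ b) :
    g {a, b} = df oc (f a) (f b) := by
  by_cases ha : a = ⊥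
  · subst ha
    rw [h0, df_bot hA, ← hf b, kalEtaF, if_neg (Ne.symm hne)]
  · have hb : b ≠ ⊥ := by
      rintro rfl; exact ha (le_bot_iff.1 hab)
    have h1 := hf a
    have h2 := hf b
    rw [kalEtaF, if_neg ha] at h1
    rw [kalEtaF, if_neg hb] at h2
    have hs : symmDiff ({a, b} : Finset P) {⊥, a} = {⊥, b} := by
      ext x
      simp only [Finset.mem_symmDiff, Finset.mem_insert, Finset.mem_singleton]
      constructor
      · tauto
      · rintro (rfl | rfl)
        · right; exact ⟨Or.inl rfl, by rintro (h | h); exacts [ha h.symm, hb h.symm]⟩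
        · left; exact ⟨Or.inr rfl, by rintro (h | h); exacts [hb h, hne h.symm]⟩
    have h3 := hom_symm hg (pair_mem hab hne) (pair_mem bot_le (Ne.symm ha)) ?_ ?_
    · rw [hs, h1, h2] at h3
      exact df_unique hA h3.1 h3.2
    · refine chn_union (chn_pair hab) (chn_pair bot_le) fun x hx y hy => ?_
      simp only [Finset.mem_insert, Finset.mem_singleton] at hx hy
      rcases hy with rfl | rfl
      · simp
      · rcases hx with rfl | rfl
        · simp
        · exact Or.inr hab
    · intro p
      rw [chi_pair hab hne, chi_pair bot_le (Ne.symm ha)]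
      tauto

theorem hom_ext (hA : IsOMP A oc) {g g' : Finset P → A} (hg : KalHomTo P A oc g)
    (hg' : KalHomTo P A oc g') {f : P → A} (h0 : f ⊥ = ⊥)
    (hf : ∀ a, g (kalEtaF ⊥ a) = f a) (hf' : ∀ a, g' (kalEtaF ⊥ a) = f a) :
    ∀ n : ℕ, ∀ C ∈ KC P, C.card ≤ n → g' C = g C := by
  have he : g' ∅ = g ∅ := by
    have h1 := hf ⊥
    have h2 := hf' ⊥
    rw [kalEtaF, if_pos rfl] at h1 h2
    rw [h1, h2]
  intro n
  induction n with
  | zero =>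
    intro C _ hn
    rw [Finset.card_eq_zero.1 (Nat.le_zero.1 hn)]; exact he
  | succ n ih =>
    intro C hC hn
    rcases C.eq_empty_or_nonempty with rfl | ⟨x, hx⟩
    · exact he
    have hC' := mem_KC.1 hC
    obtain ⟨a, b, hab, hca, -, -⟩ := mem_pair hC'.1 hC'.2 hx
    have hp := pair_mem hab.2.2.1 hab.2.2.2.1
    have hsub : ({a, b} : Finset P) ⊆ C := by
      intro y hy
      simp only [Finset.mem_insert, Finset.mem_singleton] at hy
      rcases hy with rfl | rfl
      exacts [hab.1, hab.2.1]
    have hu : C ∪ {a, b} = C := Finset.union_eq_left.2 hsub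
    have hD : symmDiff C {a, b} ∈ KC P := symm_mem hC hp (by rw [hu]; exact hC'.1)
    have hDs : symmDiff C {a, b} ⊆ C := by
      have := symm_sub C {a, b}
      rwa [hu] at this
    have hcard : (symmDiff C {a, b}).card < C.card := by
      refine Finset.card_lt_card ⟨hDs, fun h => ?_⟩
      have := h hab.1
      simp [Finset.mem_symmDiff, hab.1] at this
    have hT : Chn ({a, b} ∪ symmDiff C {a, b}) := hC'.1.sub (Finset.union_subset hsub hDs)
    have hd : ∀ p, chi ({a, b} : Finset P) p → ¬ chi (symmDiff C {a, b}) p := by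
      intro p h
      have h' := (chi_pair hab.2.2.1 hab.2.2.2.1 p).1 h
      have := hab.chi_of hC'.1 hca h'.1 h'.2
      rw [chi_symmDiff]; tauto
    have e : symmDiff {a, b} (symmDiff C {a, b}) = C := by
      rw [symmDiff_comm C, symmDiff_symmDiff_cancel_left]
    have k1 := (hom_symm hg hp hD hT hd).2
    have k2 := (hom_symm hg' hp hD hT hd).2
    rw [e] at k1 k2
    rw [hom_pair hA hg h0 hf hab.2.2.1 hab.2.2.2.1] at k1
    rw [hom_pair hA hg' h0 hf' hab.2.2.1 hab.2.2.2.1, ih _ hD (by omega)] at k2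
    exact k2.unique k1

end omp
end Kal

/-- The Kalmbach functor `K` is left adjoint to the forgetful
functor `U : OMP → BPos`, with unit `η` (`η 0 = ∅`, `η a = [0 < a]`): every
bounded-poset morphism `f : P → U(A)` into an orthomodular poset `A` lifts uniquely
to an OMP-morphism `g : K(P) → A` with `g ∘ η = f`.  Moreover the counit
`ε_A : K(U(A)) → A` (the unique lift of the identity of `U(A)`) is given by
`ε_A [x₁<…<x_{2n}] = (x₁' ∧ x₂) ∨ … ∨ (x_{2n-1}' ∧ x_{2n})`. -/
theorem kalmbach_left_adjoint_forgetful
    (P : Type u) [PartialOrder P] [BoundedOrder P] [Nontrivial P]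
    (A : Type v) [PartialOrder A] [BoundedOrder A] [Nontrivial A]
    (oc : A → A) (hA : IsOMP A oc) :
    (∀ f : P → A, Monotone f → f ⊥ = ⊥ → f ⊤ = ⊤ →
      ∃ g : Finset P → A, KalHomTo P A oc g ∧ (∀ a : P, g (kalEtaF ⊥ a) = f a) ∧
        ∀ g' : Finset P → A, KalHomTo P A oc g' → (∀ a : P, g' (kalEtaF ⊥ a) = f a) →
          ∀ C ∈ KalCarrier Set.univ ((· ≤ ·) : P → P → Prop), g' C = g C) ∧
    (∀ e : Finset A → A, KalHomTo A A oc e → (∀ a : A, e (kalEtaF ⊥ a) = a) →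
      ∀ C ∈ KalCarrier Set.univ ((· ≤ ·) : A → A → Prop),
        IsLUB {w : A | ∃ a b, KalPairR (· ≤ ·) C a b ∧ IsGLB {oc a, b} w} (e C)) := by
  constructor
  · intro f hf h0 h1
    refine ⟨Kal.gK oc f, Kal.gK_hom hA hf h0 h1, Kal.gK_eta hA hf h0, ?_⟩
    intro g' hg' hgf C hC
    exact Kal.hom_ext hA (Kal.gK_hom hA hf h0 h1) hg' h0 (Kal.gK_eta hA hf h0) hgf _ C hC le_rfl
  · intro e he hee C hC
    have hid : Monotone (fun a : A => a) := fun _ _ h => h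
    have h1 := Kal.hom_ext hA (Kal.gK_hom hA hid rfl rfl) he (f := fun a : A => a) rfl
      (Kal.gK_eta hA hid rfl) hee _ C hC le_rfl
    rw [h1]
    convert Kal.gK_lub hA hid (Kal.mem_KC.1 hC).1 using 1
    ext w
    simp only [Kal.V, Set.mem_setOf_eq]
    constructor
    · rintro ⟨a, b, hab, hw⟩
      rw [Kal.pair_iff] at hab
      exact ⟨a, b, hab.1, hab.2, hw.unique (Kal.df_glb hA hab.1.2.2.1)⟩
    · rintro ⟨a, b, hab, hc, rfl⟩
      exact ⟨a, b, Kal.pair_iff.2 ⟨hab, hc⟩, Kal.df_glb hA hab.2.2.1⟩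
end
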